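/- arXiv:0903.3289 — 3 statements merged into one kernel-verified Lean document; each statement's English description precedes it below -/
import Mathlib

section
/- Let f be a holomorphic local dynamical system at 0 ∈ ℂ tangent to the identity with multiplicity r+1 ≥ 2, i.e. f(z) = z + a_{r+1}z^{r+1} + ⋯ with a_{r+1} ≠ 0. Then f is topologically locally conjugated to the map g(z) = z − z^{r+1}. -/
open Set Filter Topology

/-- `φ` is a homeomorphism from `W₁` onto `W₂` fixing `0` which conjugates `f₁` (defined on
`U₁`) to `f₂` (defined on `U₂`). -/
def IsTopConjVia (f₁ : ℂ → ℂ) (U₁ : Set ℂ) (f₂ : ℂ → ℂ) (U₂ : Set ℂ)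
    (φ : ℂ → ℂ) (W₁ W₂ : Set ℂ) : Prop :=
  IsOpen W₁ ∧ IsOpen W₂ ∧ (0 : ℂ) ∈ W₁ ∧ (0 : ℂ) ∈ W₂ ∧ W₁ ⊆ U₁ ∧ W₂ ⊆ U₂ ∧
    ContinuousOn φ W₁ ∧ Set.BijOn φ W₁ W₂ ∧
    (∃ ψ : ℂ → ℂ, ContinuousOn ψ W₂ ∧ Set.EqOn (ψ ∘ φ) id W₁) ∧
    φ 0 = 0 ∧ ∀ z ∈ W₁, f₁ z ∈ W₁ → φ (f₁ z) = f₂ (φ z)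

/-- `f₁` and `f₂` are topologically locally conjugated at `0`. -/
def TopLocallyConj (f₁ : ℂ → ℂ) (U₁ : Set ℂ) (f₂ : ℂ → ℂ) (U₂ : Set ℂ) : Prop :=
  ∃ φ W₁ W₂, IsTopConjVia f₁ U₁ f₂ U₂ φ W₁ W₂

/-- Topological conjugacy of germs at `0`. -/
def GermConj (f g : ℂ → ℂ) : Prop :=
  ∃ e : OpenPartialHomeomorph ℂ ℂ, 0 ∈ e.source ∧ e 0 = 0 ∧ ∀ᶠ z in 𝓝 (0 : ℂ), e (f z) = g (e z)

theorem GermConj.trans {f g h : ℂ → ℂ} (h₁ : GermConj f g) (h₂ : GermConj g h) :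
    GermConj f h := by
  obtain ⟨e, he, he0, hef⟩ := h₁
  obtain ⟨e', he', he0', hef'⟩ := h₂
  refine ⟨e.trans e', by simp [he, he0, he'], by simp [he0, he0'], ?_⟩
  have hc : Tendsto e (𝓝 0) (𝓝 0) := by simpa [he0] using (e.continuousAt he).tendsto
  filter_upwards [hef, hc.eventually hef'] with z h1 h2
  simp [h1, h2]

theorem GermConj.symm {f g : ℂ → ℂ} (hf : ContinuousAt f 0) (hf0 : f 0 = 0)
    (h₁ : GermConj f g) : GermConj g f := by
  obtain ⟨e, he, he0, hef⟩ := h₁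
  have ht : (0 : ℂ) ∈ e.target := by simpa [he0] using e.map_source he
  have hs0 : e.symm 0 = 0 := by simpa [he0] using e.left_inv he
  refine ⟨e.symm, ht, hs0, ?_⟩
  have hc : Tendsto e.symm (𝓝 0) (𝓝 0) := by
    simpa [hs0] using (e.symm.continuousAt (x := 0) ht).tendsto
  have hfc : Tendsto f (𝓝 0) (𝓝 0) := by simpa [ContinuousAt, hf0] using hf
  have hsrc : ∀ᶠ z in 𝓝 (0 : ℂ), z ∈ e.source := e.open_source.mem_nhds he
  filter_upwards [hc.eventually hef, e.open_target.mem_nhds ht,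
    hc.eventually (hfc.eventually hsrc)] with y h1 h2 h3
  rw [e.right_inv h2] at h1
  rw [← h1, e.left_inv h3]

theorem GermConj.topLocallyConj {f g : ℂ → ℂ} (h : GermConj f g) {U : Set ℂ} (hU : IsOpen U)
    (h0 : (0 : ℂ) ∈ U) : TopLocallyConj f U g univ := by
  obtain ⟨e, he, he0, hef⟩ := h
  obtain ⟨V, hV, hVo, hV0⟩ := eventually_nhds_iff.1 hef
  let e' := e.restrOpen (V ∩ U) (hVo.inter hU)
  have hs : e'.source = e.source ∩ (V ∩ U) := rfl
  have h0s : (0 : ℂ) ∈ e'.source := ⟨he, hV0, h0⟩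
  have hee : (e' : ℂ → ℂ) = e := rfl
  refine ⟨e', e'.source, e'.target, e'.open_source, e'.open_target, h0s, ?_, ?_,
    subset_univ _, e'.continuousOn, e'.bijOn, ⟨e'.symm, e'.continuousOn_symm, ?_⟩, he0, ?_⟩
  · have := e'.map_source h0s
    rwa [hee, he0] at this
  · rw [hs]
    exact fun x hx => hx.2.2
  · exact fun x hx => e'.left_inv hx
  · intro z hz _
    exact hV z hz.2.1

theorem GermConj.of_linear {f g : ℂ → ℂ} {l : ℂ} (hl : l ≠ 0) (h : ∀ z, l * f z = g (l * z)) :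
    GermConj f g :=
  ⟨(Homeomorph.mulLeft₀ l hl).toOpenPartialHomeomorph, by simp, by simp,
    Eventually.of_forall (by simpa using h)⟩

/-- An additive telescoping series along the orbits of `F`, stopped in an absorbing set `D`. -/
theorem exists_orbit_sum {α : Type*} (F : α → α) (D S : Set α) (hD : ∀ x ∈ D, F x ∈ D)
    (η : α → ℂ) (hη : ∀ x ∈ D, η x = 0) (hS : ∀ x ∈ S, ∃ n, F^[n] x ∈ D) :
    ∃ u : α → ℂ, (∀ x ∈ D, u x = 0) ∧ ∀ x ∈ S, u x = η x + u (F x) := by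
  have hDn : ∀ n, ∀ x ∈ D, F^[n] x ∈ D := by
    intro n
    induction n with
    | zero => simp
    | succ n ih => intro x hx; exact ih _ (hD x hx)
  refine ⟨fun x => ∑' n, η (F^[n] x), fun x hx => ?_, fun x hx => ?_⟩
  · simp [fun n => hη _ (hDn n x hx)]
  · obtain ⟨N, hN⟩ := hS x hx
    have hsum : Summable fun n => η (F^[n] x) := by
      refine summable_of_ne_finset_zero (s := Finset.range N) fun n hn => hη _ ?_
      obtain ⟨k, rfl⟩ := Nat.exists_eq_add_of_le (not_lt.1 (mt Finset.mem_range.2 hn))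
      rw [add_comm, Function.iterate_add_apply]
      exact hDn k _ hN
    exact hsum.tsum_eq_zero_add

theorem rpow_neg_sub_half {τ t : ℝ} (hτ : 0 < τ) (ht : 1 ≤ t) :
    t ^ (-τ) + τ / 2 * t ^ (-(1 + τ)) ≤ (t - 1 / 2) ^ (-τ) := by
  have ht0 : 0 < t := by linarith
  have hx : 0 < 1 - 1 / (2 * t) := by
    rw [sub_pos, div_lt_one (by positivity)]; linarith
  have h1 : t - 1 / 2 = t * (1 - 1 / (2 * t)) := by field_simp
  have h2 : 1 + τ * (1 / (2 * t)) ≤ (1 - 1 / (2 * t)) ^ (-τ) := by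
    rw [Real.rpow_def_of_pos hx]
    have h3 := Real.log_le_sub_one_of_pos hx
    have h4 := Real.add_one_le_exp (Real.log (1 - 1 / (2 * t)) * -τ)
    nlinarith
  rw [h1, Real.mul_rpow ht0.le hx.le, neg_add, add_comm (-1 : ℝ), Real.rpow_add ht0,
    Real.rpow_neg_one]
  have h5 : 0 < t ^ (-τ) := by positivity
  calc _ = t ^ (-τ) * (1 + τ * (1 / (2 * t))) := by field_simp
    _ ≤ _ := by gcongr

theorem exists_gauge {τ L δ : ℝ} (hτ : 0 < τ) (hL : 0 ≤ L) (hδ : 0 < δ) :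
    ∀ᶠ Q : ℝ in atTop, ∃ B : ℝ → ℝ, MonotoneOn B (Ici (Q - 1 / 2)) ∧ 0 ≤ B (Q - 1 / 2) ∧
      (∀ t, Q ≤ t → B t ≤ δ) ∧ ∀ t, Q ≤ t → B (t - 1 / 2) + L * t ^ (-(1 + τ)) ≤ B t := by
  set K := 2 / τ * L
  have hK : 0 ≤ K := by positivity
  have hlim : Tendsto (fun Q : ℝ => K * (Q - 1 / 2) ^ (-τ)) atTop (𝓝 0) := by
    have := ((tendsto_rpow_neg_atTop hτ).comp
      (tendsto_atTop_add_const_right atTop (-(1 / 2) : ℝ) tendsto_id)).const_mul K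
    simpa [Function.comp_def, sub_eq_add_neg] using this
  filter_upwards [hlim.eventually (eventually_lt_nhds hδ), eventually_ge_atTop 1] with Q hQ hQ1
  refine ⟨fun t => K * ((Q - 1 / 2) ^ (-τ) - t ^ (-τ)), ?_, by simp, ?_, ?_⟩
  · intro s hs t ht hst
    have hs' : (0 : ℝ) < s := by have := mem_Ici.1 hs; linarith
    have := Real.rpow_le_rpow_of_nonpos hs' hst (by linarith : -τ ≤ 0)
    dsimp only
    gcongr
  · intro t ht
    have : 0 ≤ t ^ (-τ) := by have : 0 ≤ t := by linarith
                              positivity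
    dsimp only
    nlinarith
  · intro t ht
    have h := rpow_neg_sub_half hτ (hQ1.trans ht)
    have : L = K * (τ / 2) := by simp only [K]; field_simp
    dsimp only
    rw [this]
    nlinarith
theorem exists_radial_cutoff {C : ℝ} (hC : 0 ≤ C) : ∃ C₁, 0 ≤ C₁ ∧ ∀ (η : ℂ → ℂ) (ρ : ℝ), 0 < ρ →
    (∀ z ≠ 0, ‖z‖ < ρ → DifferentiableAt ℝ η z ∧ ‖η z‖ ≤ C * ‖z‖ ∧ ‖fderiv ℝ η z‖ ≤ C) →
    ∃ η' : ℂ → ℂ,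
      (∀ z ≠ 0, DifferentiableAt ℝ η' z ∧ ‖η' z‖ ≤ C * ρ ∧ ‖fderiv ℝ η' z‖ ≤ C₁) ∧
      (∀ z, η' z ≠ 0 → ‖z‖ < ρ ∧ η z ≠ 0) ∧ ∀ z, ‖z‖ < ρ / 2 → η' z = η z := by
  let K : ContDiffBump (0 : ℂ) := ⟨1 / 2, 3 / 4, by norm_num, by norm_num⟩
  obtain ⟨M, hM⟩ := (K.contDiff (n := 1)).lipschitzWith_of_hasCompactSupport
    K.hasCompactSupport one_ne_zero
  refine ⟨C + M * C, by positivity, fun η ρ hρ hη => ?_⟩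
  have hK0 : ∀ z : ℂ, 3 / 4 * ρ ≤ ‖z‖ → K (ρ⁻¹ • z) = 0 := by
    intro z hz
    refine K.zero_of_le_dist ?_
    rw [dist_zero_right, norm_smul, Real.norm_of_nonneg (by positivity), inv_mul_eq_div,
      le_div_iff₀ hρ]
    exact hz
  have hKd : Differentiable ℝ fun z : ℂ => K (ρ⁻¹ • z) :=
    ((K.contDiff (n := 1)).differentiable one_ne_zero).comp (by fun_prop)
  have hKn : ∀ z, ‖fderiv ℝ (fun z : ℂ => K (ρ⁻¹ • z)) z‖ ≤ M / ρ := by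
    intro z
    refine norm_fderiv_le_of_lip' ℝ (by positivity) (Eventually.of_forall fun y => ?_)
    refine (hM.norm_sub_le _ _).trans_eq ?_
    rw [← smul_sub, norm_smul, Real.norm_of_nonneg (by positivity)]
    ring
  have hK1 : ∀ z, ‖K z‖ ≤ 1 := fun z => by
    rw [Real.norm_of_nonneg K.nonneg]; exact K.le_one
  refine ⟨fun z => K (ρ⁻¹ • z) • η z, fun z hz => ?_, fun z hz => ?_, fun z hz => ?_⟩
  · rcases lt_or_ge ‖z‖ ρ with h | h
    · obtain ⟨h1, h2, h3⟩ := hη z hz h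
      have h4 : ‖η z‖ ≤ C * ρ := h2.trans (by gcongr)
      have hd := (hKd z).hasFDerivAt.fun_smul h1.hasFDerivAt
      refine ⟨hd.differentiableAt, ?_, ?_⟩
      · rw [norm_smul]
        calc _ ≤ 1 * (C * ρ) := by gcongr; exact hK1 _
          _ = _ := one_mul _
      · rw [hd.fderiv]
        refine (norm_add_le _ _).trans ?_
        rw [norm_smul, ContinuousLinearMap.norm_smulRight_apply]
        calc _ ≤ 1 * C + M / ρ * (C * ρ) := by
              gcongr
              · exact hK1 _
              · exact hKn z
          _ = _ := by field_simp
    · have h0 : (fun z => K (ρ⁻¹ • z) • η z) =ᶠ[𝓝 z] fun _ => 0 := by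
        filter_upwards [continuous_norm.continuousAt.eventually
          (lt_mem_nhds (show 3 / 4 * ρ < ‖z‖ by linarith))] with y hy
        rw [hK0 y hy.le, zero_smul]
      refine ⟨(differentiableAt_const _).congr_of_eventuallyEq h0, ?_, ?_⟩
      · simp only [h0.eq_of_nhds, norm_zero]; positivity
      · rw [h0.fderiv_eq]; simp; positivity
  · refine ⟨?_, (smul_ne_zero_iff.1 hz).2⟩
    by_contra h
    exact (smul_ne_zero_iff.1 hz).1 (hK0 z (by linarith))
  · have : K (ρ⁻¹ • z) = 1 := by
      refine K.one_of_mem_closedBall ?_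
      rw [mem_closedBall_zero_iff, norm_smul, Real.norm_of_nonneg (by positivity), inv_mul_eq_div,
        div_le_iff₀ hρ]
      change _ ≤ 1 / 2 * ρ
      linarith
    simp only [this, one_smul]

/-- The inductive estimate for the solution of `u (p z) = u z - η z`, where the potential `q`
increases along orbits of `p` and `η` vanishes once `q > -Q`. -/
theorem exists_solution_of_potential {s : ℕ} {p η : ℂ → ℂ} {q : ℂ → ℝ} {B : ℝ → ℝ}
    {ρ Q m b C C₁ : ℝ} (hC : 0 ≤ C) (hm : 0 ≤ m) (hQ1 : 1 ≤ Q) (hb : 0 ≤ b) (hb1 : b ≤ 1)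
    (hp : ∀ z ≠ 0, ‖z‖ < ρ → DifferentiableAt ℂ p z ∧ p z ≠ 0 ∧ q z + 1 / 2 ≤ q (p z) ∧
      ‖deriv p z‖ * ‖z‖ ^ s ≤ ‖p z‖ ^ s * (1 + C * ‖z‖ ^ s))
    (hQ : ∀ z ≠ 0, ρ ≤ ‖z‖ → -Q < q z) (hqc : ∀ z ≠ 0, ContinuousAt q z)
    (hη : ∀ z ≠ 0, DifferentiableAt ℝ η z ∧ ‖η z‖ ≤ m ∧ ‖fderiv ℝ η z‖ ≤ C₁)
    (hsupp : ∀ z ≠ 0, -Q < q z → η z = 0)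
    (hBm : MonotoneOn B (Ici (Q - 1 / 2))) (hB0 : 0 ≤ B (Q - 1 / 2)) (hBb : ∀ t, Q ≤ t → B t ≤ b)
    (hB : ∀ z ≠ 0, q z ≤ -Q → (C₁ + C) * ‖z‖ ^ s + B (-q z - 1 / 2) ≤ B (-q z)) :
    ∃ u : ℂ → ℂ, (∀ z ≠ 0, ‖z‖ < ρ → u z = η z + u (p z)) ∧
      ∀ z ≠ 0, DifferentiableAt ℝ u z ∧ ‖u z‖ ≤ 2 * m * |q z| ∧ ‖z‖ ^ s * ‖fderiv ℝ u z‖ ≤ b := by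
  classical
  let F : ℂ → ℂ := fun z => if ‖z‖ < ρ then p z else z
  let D : Set ℂ := {z | z ≠ 0 ∧ -Q < q z}
  have hFs : ∀ z, ‖z‖ < ρ → F z = p z := fun z hz => if_pos hz
  have hF : ∀ x ∈ D, F x ∈ D := by
    rintro x ⟨hx0, hx⟩
    by_cases h : ‖x‖ < ρ
    · rw [hFs x h]
      obtain ⟨-, h1, h2, -⟩ := hp x hx0 h
      exact ⟨h1, by linarith⟩
    · simpa only [F, if_neg h] using ⟨hx0, hx⟩
  have hlt : ∀ z ≠ 0, q z ≤ -Q → ‖z‖ < ρ := by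
    intro z hz hq
    by_contra h
    linarith [hQ z hz (not_lt.1 h)]
  have hesc : ∀ n : ℕ, ∀ z ≠ 0, -Q - n / 2 < q z → ∃ k, F^[k] z ∈ D := by
    intro n
    induction n with
    | zero => intro z hz h; exact ⟨0, hz, by simpa using h⟩
    | succ n ih =>
      intro z hz h
      by_cases hq : -Q < q z
      · exact ⟨0, hz, hq⟩
      · have hzρ := hlt z hz (not_lt.1 hq)
        obtain ⟨-, h1, h2, -⟩ := hp z hz hzρ
        push_cast at h
        obtain ⟨k, hk⟩ := ih (F z) (by rwa [hFs z hzρ]) (by rw [hFs z hzρ]; linarith)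
        exact ⟨k + 1, by rwa [Function.iterate_succ_apply]⟩
  have hex : ∀ z : ℂ, ∃ n : ℕ, -Q - n / 2 < q z := by
    intro z
    obtain ⟨n, hn⟩ := exists_nat_gt (2 * (-Q - q z))
    exact ⟨n, by linarith⟩
  obtain ⟨u, huD, hu⟩ := exists_orbit_sum F D {z | z ≠ 0} hF η (fun x hx => hsupp x hx.1 hx.2)
    (fun z hz => (hex z).elim fun n hn => hesc n z hz hn)
  have hu' : ∀ z ≠ 0, ‖z‖ < ρ → u z = η z + u (p z) := fun z hz h => by
    rw [hu z hz, hFs z h]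
  have hD : ∀ z ≠ 0, -Q < q z → DifferentiableAt ℝ u z ∧ u z = 0 ∧ fderiv ℝ u z = 0 := by
    intro z hz h
    have h0 : u =ᶠ[𝓝 z] fun _ => 0 := by
      filter_upwards [isOpen_ne.mem_nhds hz, (hqc z hz).eventually (lt_mem_nhds h)] with y hy hy'
      exact huD y ⟨hy, hy'⟩
    exact ⟨(differentiableAt_const _).congr_of_eventuallyEq h0, h0.eq_of_nhds,
      by rw [h0.fderiv_eq]; simp⟩
  have key : ∀ n : ℕ, ∀ z ≠ 0, -Q - n / 2 < q z → q z ≤ -Q →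
      DifferentiableAt ℝ u z ∧ ‖u z‖ ≤ 2 * m * (-q z) ∧ ‖z‖ ^ s * ‖fderiv ℝ u z‖ ≤ B (-q z) := by
    intro n
    induction n with
    | zero => intro z hz h h'; simp at h; linarith
    | succ n ih =>
      intro z hz h hq
      have hzρ := hlt z hz hq
      obtain ⟨h1, h2, h3, h4⟩ := hp z hz hzρ
      obtain ⟨g1, g2, g3⟩ := hη z hz
      push_cast at h
      obtain ⟨i1, i2, i3⟩ : DifferentiableAt ℝ u (p z) ∧ ‖u (p z)‖ ≤ 2 * m * (-q z - 1 / 2) ∧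
          ‖p z‖ ^ s * ‖fderiv ℝ u (p z)‖ ≤ B (-q z - 1 / 2) := by
        by_cases hpq : -Q < q (p z)
        · obtain ⟨j1, j2, j3⟩ := hD _ h2 hpq
          refine ⟨j1, ?_, ?_⟩
          · rw [j2, norm_zero]
            have : 0 ≤ -q z - 1 / 2 := by linarith
            positivity
          · rw [j3, norm_zero, mul_zero]
            refine hB0.trans (hBm ?_ ?_ ?_) <;> simp <;> linarith
        · obtain ⟨j1, j2, j3⟩ := ih (p z) h2 (by linarith) (not_lt.1 hpq)
          have hpq := not_lt.1 hpq
          refine ⟨j1, j2.trans (by gcongr; linarith), j3.trans (hBm ?_ ?_ ?_)⟩ <;>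
            simp <;> linarith
      have hcomp : HasFDerivAt (fun y => u (p y))
          ((fderiv ℝ u (p z)).comp ((fderiv ℂ p z).restrictScalars ℝ)) z :=
        i1.hasFDerivAt.comp z (h1.hasFDerivAt.restrictScalars ℝ)
      have hue : u =ᶠ[𝓝 z] fun y => η y + u (p y) := by
        filter_upwards [isOpen_ne.mem_nhds hz,
          continuous_norm.continuousAt.eventually (gt_mem_nhds hzρ)] with y hy hy'
        exact hu' y hy hy'
      have hd := (g1.hasFDerivAt.add hcomp).congr_of_eventuallyEq hue
      refine ⟨hd.differentiableAt, ?_, ?_⟩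
      · rw [hu' z hz hzρ]
        linarith [norm_add_le (η z) (u (p z))]
      · rw [hd.fderiv]
        have e1 : ‖fderiv ℝ η z + (fderiv ℝ u (p z)).comp ((fderiv ℂ p z).restrictScalars ℝ)‖ ≤
            C₁ + ‖fderiv ℝ u (p z)‖ * ‖deriv p z‖ := by
          refine (norm_add_le _ _).trans (add_le_add g3 ?_)
          refine (ContinuousLinearMap.opNorm_comp_le _ _).trans_eq ?_
          rw [ContinuousLinearMap.norm_restrictScalars, norm_deriv_eq_norm_fderiv]
        have hx : 0 ≤ ‖z‖ ^ s := by positivity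
        have hmono : B (-q z - 1 / 2) ≤ B (-q z) := by
          refine hBm ?_ ?_ ?_ <;> simp <;> linarith
        have hBle : B (-q z - 1 / 2) ≤ 1 :=
          hmono.trans ((hBb _ (by linarith)).trans hb1)
        calc ‖z‖ ^ s * _ ≤ ‖z‖ ^ s * (C₁ + ‖fderiv ℝ u (p z)‖ * ‖deriv p z‖) := by gcongr
          _ = C₁ * ‖z‖ ^ s + ‖fderiv ℝ u (p z)‖ * (‖deriv p z‖ * ‖z‖ ^ s) := by ring
          _ ≤ C₁ * ‖z‖ ^ s + ‖fderiv ℝ u (p z)‖ * (‖p z‖ ^ s * (1 + C * ‖z‖ ^ s)) := by gcongr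
          _ = C₁ * ‖z‖ ^ s + (‖p z‖ ^ s * ‖fderiv ℝ u (p z)‖) * (1 + C * ‖z‖ ^ s) := by ring
          _ ≤ C₁ * ‖z‖ ^ s + B (-q z - 1 / 2) * (1 + C * ‖z‖ ^ s) := by gcongr
          _ = C₁ * ‖z‖ ^ s + B (-q z - 1 / 2) + B (-q z - 1 / 2) * (C * ‖z‖ ^ s) := by ring
          _ ≤ C₁ * ‖z‖ ^ s + B (-q z - 1 / 2) + 1 * (C * ‖z‖ ^ s) := by gcongr
          _ = (C₁ + C) * ‖z‖ ^ s + B (-q z - 1 / 2) := by ring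
          _ ≤ _ := hB z hz hq
  refine ⟨u, hu', fun z hz => ?_⟩
  by_cases hq : -Q < q z
  · obtain ⟨j1, j2, j3⟩ := hD z hz hq
    refine ⟨j1, ?_, ?_⟩
    · rw [j2, norm_zero]; positivity
    · rw [j3, norm_zero, mul_zero]; exact hb
  · obtain ⟨n, hn⟩ := hex z
    obtain ⟨j1, j2, j3⟩ := key n z hz hn (not_lt.1 hq)
    refine ⟨j1, j2.trans ?_, j3.trans (hBb _ (by linarith))⟩
    gcongr
    exact neg_le_abs _

theorem norm_pow_succ_le_rpow {r : ℕ} (hr : 1 ≤ r) {a z : ℂ} (hz : z ≠ 0) {t : ℝ}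
    (ht : 0 < t) (h : t ≤ 2 * ‖a / z ^ r‖) :
    ‖z‖ ^ (r + 1) ≤ (2 * ‖a‖) ^ (1 + (r : ℝ)⁻¹) * t ^ (-(1 + (r : ℝ)⁻¹)) := by
  have hr0 : (r : ℝ) ≠ 0 := by positivity
  have hz0 : 0 < ‖z‖ ^ r := by positivity
  have h1 : ‖z‖ ^ r ≤ 2 * ‖a‖ / t := by
    rw [norm_div, norm_pow, ← mul_div_assoc, le_div_iff₀ hz0] at h
    rw [le_div_iff₀ ht]
    linarith
  have h2 : ‖z‖ ^ (r + 1) = (‖z‖ ^ r) ^ (1 + (r : ℝ)⁻¹) := by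
    rw [← Real.rpow_natCast ‖z‖ r, ← Real.rpow_mul (norm_nonneg z), ← Real.rpow_natCast]
    congr 1
    push_cast
    field_simp
  rw [h2, Real.rpow_neg ht.le, ← div_eq_mul_inv, ← Real.div_rpow (by positivity) ht.le]
  exact Real.rpow_le_rpow hz0.le h1 (by positivity)

theorem abs_re_sub_abs_im_le (w : ℂ) : |w.re - (|w.im|)| ≤ 2 * ‖w‖ := by
  have h1 := Complex.abs_re_le_norm w
  have h2 := Complex.abs_im_le_norm w
  have h3 := abs_sub w.re |w.im|
  rw [abs_abs] at h3
  linarith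

/-- If `a / z ^ r` is a coordinate in which `p` is close to the unit translation, and `η` is
supported where this coordinate points away from the direction of the translation, then
`u (p z) = u z - η z` has a solution that is small in the `C¹` sense. -/
theorem exists_small_solution {r : ℕ} (hr : 1 ≤ r) {a : ℂ} (ha : a ≠ 0) {c C : ℝ} (hc : 0 < c)
    (hC : 0 ≤ C) {p e η : ℂ → ℂ}
    (hp : ∀ᶠ z in 𝓝[≠] (0 : ℂ), DifferentiableAt ℂ p z ∧ p z ≠ 0 ∧
      a / p z ^ r = a / z ^ r + 1 + e z ∧ ‖e z‖ ≤ 1 / 4 ∧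
      ‖deriv p z‖ * ‖z‖ ^ (r + 1) ≤ ‖p z‖ ^ (r + 1) * (1 + C * ‖z‖ ^ (r + 1)))
    (hη : ∀ᶠ z in 𝓝[≠] (0 : ℂ), DifferentiableAt ℝ η z ∧ ‖η z‖ ≤ C * ‖z‖ ∧
      ‖fderiv ℝ η z‖ ≤ C ∧
      (η z ≠ 0 → (a / z ^ r).re - |(a / z ^ r).im| ≤ -c * ‖a / z ^ r‖))
    {δ : ℝ} (hδ : 0 < δ) :
    ∃ u : ℂ → ℂ, ∀ᶠ z in 𝓝[≠] (0 : ℂ), DifferentiableAt ℝ u z ∧ ‖z ^ r * u z‖ ≤ δ ∧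
      ‖z‖ ^ (r + 1) * ‖fderiv ℝ u z‖ ≤ δ ∧ u (p z) = u z - η z := by
  obtain ⟨C₁, hC₁, hcut⟩ := exists_radial_cutoff hC
  obtain ⟨ρ, hρ, H⟩ := Metric.eventually_nhds_iff.1
    (eventually_nhdsWithin_iff.1 (hp.and hη))
  simp only [dist_zero_right, mem_compl_iff, mem_singleton_iff] at H
  set q : ℂ → ℝ := fun z => (a / z ^ r).re - |(a / z ^ r).im| with hq
  have hτ : 0 < (r : ℝ)⁻¹ := by positivity
  set K₁ := (2 * ‖a‖) ^ (1 + (r : ℝ)⁻¹)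
  have hK₁ : 0 ≤ K₁ := by positivity
  obtain ⟨Q, ⟨B, hBm, hB0, hBb, hB⟩, hQ1, hQR⟩ := ((exists_gauge hτ
    (by positivity : 0 ≤ (C₁ + C) * K₁) (by positivity : 0 < min δ 1)).and
    ((eventually_ge_atTop 1).and (eventually_gt_atTop (2 * (‖a‖ / ρ ^ r))))).exists
  have ha' : 0 < ‖a‖ := norm_pos_iff.2 ha
  obtain ⟨σ, hσ, hσρ, hσ1, hσQ, hσδ⟩ : ∃ σ : ℝ, 0 < σ ∧ σ ≤ ρ ∧ σ ≤ 1 ∧ σ ≤ c * ‖a‖ / Q ∧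
      σ ≤ δ / (4 * C * ‖a‖ + 1) := by
    refine ⟨min (min ρ 1) (min (c * ‖a‖ / Q) (δ / (4 * C * ‖a‖ + 1))), by positivity, ?_, ?_, ?_, ?_⟩
      <;> simp
  obtain ⟨η', hη'1, hη'2, hη'3⟩ := hcut η σ hσ fun z hz h =>
    have := (H (h.trans_le hσρ) hz).2
    ⟨this.1, this.2.1, this.2.2.1⟩
  have hstep : ∀ z ≠ 0, ‖z‖ < ρ → DifferentiableAt ℂ p z ∧ p z ≠ 0 ∧ q z + 1 / 2 ≤ q (p z) ∧
      ‖deriv p z‖ * ‖z‖ ^ (r + 1) ≤ ‖p z‖ ^ (r + 1) * (1 + C * ‖z‖ ^ (r + 1)) := by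
    intro z hz h
    obtain ⟨⟨h1, h2, h3, h4, h5⟩, -⟩ := H h hz
    refine ⟨h1, h2, ?_, h5⟩
    simp only [hq, h3, Complex.add_re, Complex.add_im, Complex.one_re, Complex.one_im, add_zero]
    have e1 := (abs_le.1 ((Complex.abs_re_le_norm (e z)).trans h4)).1
    have e2 := (Complex.abs_im_le_norm (e z)).trans h4
    have e3 := abs_add_le (a / z ^ r).im (e z).im
    linarith
  have hout : ∀ z ≠ 0, ρ ≤ ‖z‖ → -Q < q z := by
    intro z hz h
    have h1 : ‖a / z ^ r‖ ≤ ‖a‖ / ρ ^ r := by rw [norm_div, norm_pow]; gcongr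
    have h2 := (abs_le.1 (abs_re_sub_abs_im_le (a / z ^ r))).1
    simp only [hq]
    linarith
  have hqc : ∀ z ≠ 0, ContinuousAt q z := by
    intro z hz
    have : ContinuousAt (fun z : ℂ => a / z ^ r) z :=
      continuousAt_const.div (continuousAt_id.pow r) (pow_ne_zero r hz)
    exact (Complex.continuous_re.continuousAt.comp this).sub
      (Complex.continuous_im.continuousAt.comp this).abs
  have hsupp : ∀ z ≠ 0, -Q < q z → η' z = 0 := by
    intro z hz hqz
    by_contra h
    obtain ⟨h1, h2⟩ := hη'2 z h
    have h3 := (H (h1.trans_le hσρ) hz).2.2.2.2 h2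
    have hz0 : 0 < ‖z‖ := norm_pos_iff.2 hz
    have h4 : ‖z‖ ^ r ≤ c * ‖a‖ / Q :=
      ((pow_le_of_le_one hz0.le (h1.le.trans hσ1) (by omega)).trans h1.le).trans hσQ
    have h5 : Q ≤ c * ‖a / z ^ r‖ := by
      rw [norm_div, norm_pow, ← mul_div_assoc, le_div_iff₀ (by positivity)]
      rw [le_div_iff₀ (by positivity)] at h4
      linarith
    linarith
  have hgauge : ∀ z ≠ 0, q z ≤ -Q →
      (C₁ + C) * ‖z‖ ^ (r + 1) + B (-q z - 1 / 2) ≤ B (-q z) := by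
    intro z hz hqz
    have ht : Q ≤ -q z := by linarith
    have h1 := hB _ ht
    have h2 := norm_pow_succ_le_rpow (a := a) hr hz (t := -q z) (by linarith)
      ((neg_le_abs _).trans (abs_re_sub_abs_im_le _))
    have h3 : (C₁ + C) * ‖z‖ ^ (r + 1) ≤ (C₁ + C) * (K₁ * (-q z) ^ (-(1 + (r : ℝ)⁻¹))) := by
      gcongr
    linarith
  obtain ⟨u, hu, hu'⟩ := exists_solution_of_potential hC (by positivity : 0 ≤ C * σ) hQ1
    (by positivity : 0 ≤ min δ 1) (min_le_right _ _) hstep hout hqc hη'1 hsupp hBm hB0 hBb hgauge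
  refine ⟨u, ?_⟩
  rw [eventually_nhdsWithin_iff]
  filter_upwards [Metric.ball_mem_nhds (0 : ℂ) (half_pos hσ)] with z hzσ hz
  rw [mem_ball_zero_iff] at hzσ
  obtain ⟨h1, h2, h3⟩ := hu' z hz
  refine ⟨h1, ?_, h3.trans (min_le_left _ _), ?_⟩
  · have hz0 : ‖z‖ ^ r ≠ 0 := pow_ne_zero r (norm_ne_zero_iff.2 hz)
    calc ‖z ^ r * u z‖ = ‖z‖ ^ r * ‖u z‖ := by simp
      _ ≤ ‖z‖ ^ r * (2 * (C * σ) * (2 * ‖a / z ^ r‖)) := by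
        gcongr
        exact h2.trans (by gcongr; exact abs_re_sub_abs_im_le _)
      _ = 4 * C * ‖a‖ * σ := by rw [norm_div, norm_pow]; field_simp; ring
      _ ≤ (4 * C * ‖a‖ + 1) * (δ / (4 * C * ‖a‖ + 1)) := by gcongr; linarith
      _ = δ := by field_simp
  · rw [hu z hz (by linarith), hη'3 z hzσ]; ring

/-- `f` is a parabolic germ for which `a / z ^ r` is an approximate Fatou coordinate, up to the
analytic error `e`. -/
structure IsParabolic (r : ℕ) (a : ℂ) (f e : ℂ → ℂ) : Prop where
  analyticAt : AnalyticAt ℂ f 0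
  map_zero : f 0 = 0
  hasDerivAt : HasDerivAt f 1 0
  analyticAt_err : AnalyticAt ℂ e 0
  err_zero : e 0 = 0
  coord : ∀ᶠ z in 𝓝[≠] (0 : ℂ), f z ≠ 0 ∧ a / f z ^ r = a / z ^ r + 1 + e z

theorem isParabolic_of_eventuallyEq {r : ℕ} (hr : 1 ≤ r) {f m : ℂ → ℂ} (hm : AnalyticAt ℂ m 0)
    (hm0 : m 0 ≠ 0) (hf : ∀ᶠ z in 𝓝 (0 : ℂ), f z = z + z ^ (r + 1) * m z) :
    ∃ e, IsParabolic r (-(1 / (r * m 0))) f e := by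
  have hr0 : (r : ℂ) ≠ 0 := by simp; omega
  set a : ℂ := -(1 / (r * m 0)) with ha
  have hfe : (fun z => z + z ^ (r + 1) * m z) =ᶠ[𝓝 0] f := hf.mono fun z h => h.symm
  have hfa : AnalyticAt ℂ f 0 := AnalyticAt.congr (by fun_prop) hfe
  have hk : AnalyticAt ℂ (fun z => 1 + z ^ r * m z) 0 := by fun_prop
  have hk0 : (1 : ℂ) + 0 ^ r * m 0 = 1 := by simp [show r ≠ 0 by omega]
  have hk1 : (1 : ℂ) + 0 ^ r * m 0 ≠ 0 := by simp [hk0]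
  have hy : AnalyticAt ℂ (fun z => (1 + z ^ r * m z)⁻¹) 0 := hk.fun_inv hk1
  refine ⟨fun z => a * (-(m z * (1 + z ^ r * m z)⁻¹ *
    ∑ i ∈ Finset.range r, (1 + z ^ r * m z)⁻¹ ^ i)) - 1, hfa, ?_, ?_, ?_, ?_, ?_⟩
  · simpa using hf.self_of_nhds
  · have h1 : HasDerivAt (fun z : ℂ => z + z ^ (r + 1) * m z)
        (1 + (((r + 1 : ℕ) : ℂ) * 0 ^ r * 1 * m 0 + 0 ^ (r + 1) * deriv m 0)) 0 :=
      (hasDerivAt_id 0).add (((hasDerivAt_id (0 : ℂ)).fun_pow (r + 1)).mul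
        hm.differentiableAt.hasDerivAt)
    have h2 : HasDerivAt (fun z : ℂ => z + z ^ (r + 1) * m z) 1 0 := by
      simpa [show r ≠ 0 by omega] using h1
    exact h2.congr_of_eventuallyEq hf
  · have : AnalyticAt ℂ (fun z => ∑ i ∈ Finset.range r, (1 + z ^ r * m z)⁻¹ ^ i) 0 :=
      Finset.analyticAt_fun_sum _ fun i _ => hy.fun_pow i
    exact (analyticAt_const.fun_mul (((hm.fun_mul hy).fun_mul this).fun_neg)).fun_sub analyticAt_const
  · simp only [hk0]
    simp [ha]
    field_simp
    simp
  · rw [eventually_nhdsWithin_iff]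
    filter_upwards [hf, hk.continuousAt.eventually_ne hk1] with z h1 h2 hz
    have hz : z ≠ 0 := hz
    have h3 : f z = z * (1 + z ^ r * m z) := by rw [h1]; ring
    refine ⟨by rw [h3]; exact mul_ne_zero hz h2, ?_⟩
    have h4 := geom_sum_mul ((1 + z ^ r * m z)⁻¹) r
    have h5 : (1 + z ^ r * m z)⁻¹ - 1 = -(z ^ r * m z * (1 + z ^ r * m z)⁻¹) := by
      field_simp; ring
    have h6 : (1 + z ^ r * m z)⁻¹ ^ r = 1 - z ^ r * (m z * (1 + z ^ r * m z)⁻¹ *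
        ∑ i ∈ Finset.range r, (1 + z ^ r * m z)⁻¹ ^ i) := by
      rw [h5] at h4
      linear_combination -h4
    rw [h3, mul_pow, div_eq_mul_inv, mul_inv, ← inv_pow (1 + z ^ r * m z), h6]
    field_simp
    ring

namespace IsParabolic

variable {r : ℕ} {a : ℂ} {f e : ℂ → ℂ}

theorem tendsto (h : IsParabolic r a f e) : Tendsto f (𝓝[≠] 0) (𝓝[≠] 0) := by
  refine tendsto_nhdsWithin_iff.2 ⟨?_, h.coord.mono fun z hz => hz.1⟩
  have := h.analyticAt.continuousAt.tendsto
  rw [h.map_zero] at this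
  exact this.mono_left nhdsWithin_le_nhds

theorem exists_bound (h : IsParabolic r a f e) (hr : 1 ≤ r) (ha : a ≠ 0) :
    ∃ C : ℝ, 0 ≤ C ∧ ∀ᶠ z in 𝓝[≠] (0 : ℂ), DifferentiableAt ℂ f z ∧ f z ≠ 0 ∧
      a / f z ^ r = a / z ^ r + 1 + e z ∧ ‖e z‖ ≤ 1 / 4 ∧
      ‖deriv f z‖ * ‖z‖ ^ (r + 1) ≤ ‖f z‖ ^ (r + 1) * (1 + C * ‖z‖ ^ (r + 1)) := by
  have hr0 : (r : ℂ) ≠ 0 := by simp; omega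
  obtain ⟨M, hM⟩ : ∃ M, ∀ᶠ z in 𝓝 (0 : ℂ), ‖deriv e z‖ ≤ M :=
    ⟨‖deriv e 0‖ + 1, h.analyticAt_err.deriv.continuousAt.norm.eventually_le_const (by simp)⟩
  have hM0 : 0 ≤ M := (norm_nonneg _).trans hM.self_of_nhds
  refine ⟨M / (r * ‖a‖), by positivity, ?_⟩
  have hesmall : ∀ᶠ z in 𝓝 (0 : ℂ), ‖e z‖ ≤ 1 / 4 :=
    h.analyticAt_err.continuousAt.norm.eventually_le_const (by simp [h.err_zero])
  have hco := eventually_eventually_nhds.2 (eventually_nhdsWithin_iff.1 h.coord)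
  rw [eventually_nhdsWithin_iff]
  filter_upwards [hco, hM, hesmall, h.analyticAt.eventually_analyticAt,
    h.analyticAt_err.eventually_analyticAt] with z h1 h2 h3 h4 h5 hz
  have hz : z ≠ 0 := hz
  obtain ⟨h6, h7⟩ := h1.self_of_nhds hz
  refine ⟨h4.differentiableAt, h6, h7, h3, ?_⟩
  have d1 : HasDerivAt (fun z => a / f z ^ r)
      ((0 * f z ^ r - a * (r * f z ^ (r - 1) * deriv f z)) / (f z ^ r) ^ 2) z :=
    (hasDerivAt_const z a).div (h4.differentiableAt.hasDerivAt.fun_pow r) (pow_ne_zero r h6)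
  have d2 : HasDerivAt (fun z => a / z ^ r + 1 + e z)
      ((0 * z ^ r - a * (r * z ^ (r - 1) * 1)) / (z ^ r) ^ 2 + deriv e z) z :=
    (((hasDerivAt_const z a).div ((hasDerivAt_id z).fun_pow r) (pow_ne_zero r hz)).add_const
      1).add h5.differentiableAt.hasDerivAt
  have heq : (fun z => a / f z ^ r) =ᶠ[𝓝 z] fun z => a / z ^ r + 1 + e z := by
    filter_upwards [h1, isOpen_ne.mem_nhds hz] with y hy hy0
    exact (hy hy0).2
  have d3 := d1.unique (d2.congr_of_eventuallyEq heq)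
  obtain ⟨k, rfl⟩ : ∃ k, r = k + 1 := ⟨r - 1, by omega⟩
  have key : deriv f z * z ^ (k + 1 + 1) =
      f z ^ (k + 1 + 1) * (1 - deriv e z / (((k + 1 : ℕ) : ℂ) * a) * z ^ (k + 1 + 1)) := by
    simp only [Nat.add_sub_cancel] at d3
    field_simp at d3 ⊢
    have hzk : z ^ k ≠ 0 := pow_ne_zero k hz
    have hfk : f z ^ k ≠ 0 := pow_ne_zero k h6
    refine mul_left_cancel₀ (mul_ne_zero hzk hfk) ?_
    ring_nf at d3 ⊢
    linear_combination -d3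
  calc ‖deriv f z‖ * ‖z‖ ^ (k + 1 + 1) = ‖deriv f z * z ^ (k + 1 + 1)‖ := by simp
    _ = ‖f z‖ ^ (k + 1 + 1) *
        ‖1 - deriv e z / (((k + 1 : ℕ) : ℂ) * a) * z ^ (k + 1 + 1)‖ := by
      rw [key, norm_mul, norm_pow]
    _ ≤ _ := by
      gcongr
      refine (norm_sub_le _ _).trans ?_
      rw [norm_one, norm_mul, norm_div, norm_mul, norm_pow, Complex.norm_natCast]
      gcongr

/-- The inverse of a parabolic germ is parabolic. -/
theorem exists_inverse (h : IsParabolic r a f e) :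
    ∃ g, IsParabolic r (-a) g (e ∘ g) ∧ ∀ᶠ z in 𝓝 (0 : ℂ), g (f z) = z := by
  have hd : deriv f 0 = 1 := h.hasDerivAt.deriv
  have hd' : deriv f 0 ≠ 0 := by simp [hd]
  have hga := h.analyticAt.analyticAt_localInverse hd'
  have hgd := (h.analyticAt.hasStrictDerivAt.to_localInverse hd').hasDerivAt
  have hleft := h.analyticAt.hasStrictDerivAt.eventually_left_inverse hd'
  have hright := h.analyticAt.hasStrictDerivAt.eventually_right_inverse hd'
  set g := h.analyticAt.hasStrictDerivAt.localInverse _ _ _ hd'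
  rw [h.map_zero] at hga hgd hright
  have hg0 : g 0 = 0 := by simpa [h.map_zero] using hleft.self_of_nhds
  refine ⟨g, ⟨hga, hg0, by simpa [hd] using hgd, ?_, by simp [hg0, h.err_zero], ?_⟩, hleft⟩
  · exact AnalyticAt.comp (by rw [hg0]; exact h.analyticAt_err) hga
  · have hgt : Tendsto g (𝓝 0) (𝓝 0) := by simpa [hg0] using hga.continuousAt.tendsto
    rw [eventually_nhdsWithin_iff]
    filter_upwards [hright, hgt.eventually (eventually_nhdsWithin_iff.1 h.coord)] with y h1 h2 hy
    have hy : y ≠ 0 := hy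
    have hgy : g y ≠ 0 := by
      intro h0
      rw [h0, h.map_zero] at h1
      exact hy h1.symm
    refine ⟨hgy, ?_⟩
    have h3 := (h2 hgy).2
    rw [h1] at h3
    rw [neg_div, neg_div, h3, Function.comp_apply]
    ring

end IsParabolic

/-- A smooth angular cutoff adapted to the sectors where `a / z ^ r` has negative real part. -/
theorem exists_angular_cutoff (r : ℕ) {a : ℂ} (ha : a ≠ 0) :
    ∃ χ : ℂ → ℝ, ∃ L : ℝ, 0 ≤ L ∧ ∀ z, z ≠ 0 → DifferentiableAt ℝ χ z ∧ 0 ≤ χ z ∧ χ z ≤ 1 ∧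
      ‖fderiv ℝ χ z‖ ≤ L / ‖z‖ ∧ (χ z ≠ 0 → (a / z ^ r).re ≤ ‖a / z ^ r‖ / 2) ∧
      (χ z ≠ 1 → -(‖a / z ^ r‖ / 2) ≤ (a / z ^ r).re) := by
  set χ : ℂ → ℝ := fun z => Real.smoothTransition (1 / 2 - (a / z ^ r).re / ‖a / z ^ r‖) with hχ
  have hsm : ∀ z, z ≠ 0 → ContDiffAt ℝ 1 χ z := by
    intro z hz
    have h1 : ContDiffAt ℝ 1 (fun z : ℂ => a / z ^ r) z := by
      simp only [div_eq_mul_inv]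
      have h : ContDiffAt ℝ 1 (fun z : ℂ => z ^ r) z := by fun_prop
      exact contDiffAt_const.mul (h.inv (pow_ne_zero r hz))
    have h0 : a / z ^ r ≠ 0 := div_ne_zero ha (pow_ne_zero r hz)
    have h2 : ContDiffAt ℝ 1 (fun z : ℂ => (a / z ^ r).re) z :=
      Complex.reCLM.contDiff.contDiffAt.comp z h1
    exact Real.smoothTransition.contDiff.contDiffAt.comp z
      (contDiffAt_const.sub (h2.div (h1.norm ℝ h0) (norm_ne_zero_iff.2 h0)))
  have hhom : ∀ (t : ℝ) (z : ℂ), 0 < t → χ (t • z) = χ z := by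
    intro t z ht
    have h1 : a / (t • z) ^ r = ((t ^ r)⁻¹ : ℝ) • (a / z ^ r) := by
      simp only [Complex.real_smul, mul_pow]
      push_cast
      field_simp
    have h2 : (0 : ℝ) < (t ^ r)⁻¹ := by positivity
    simp only [hχ, h1, norm_smul, Complex.smul_re, smul_eq_mul, Real.norm_of_nonneg h2.le]
    rw [mul_div_mul_left _ _ h2.ne']
  obtain ⟨L, hL⟩ : ∃ L, ∀ x ∈ Metric.sphere (0 : ℂ) 1, ‖fderiv ℝ χ x‖ ≤ L := by
    refine (isCompact_sphere (0 : ℂ) 1).exists_bound_of_continuousOn fun x hx => ?_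
    have hx0 : x ≠ 0 := by
      rintro rfl
      simp at hx
    exact ((hsm x hx0).continuousAt_fderiv (by simp)).continuousWithinAt
  have hL0 : 0 ≤ L := (norm_nonneg _).trans (hL 1 (by simp))
  refine ⟨χ, L, hL0, fun z hz => ⟨(hsm z hz).differentiableAt (by simp),
    Real.smoothTransition.nonneg _, Real.smoothTransition.le_one _, ?_, ?_, ?_⟩⟩
  · have hzn : 0 < ‖z‖ := norm_pos_iff.2 hz
    have h1 : (fun x => χ (‖z‖⁻¹ • x)) = χ := funext fun x => hhom _ x (by positivity)
    have h2 : fderiv ℝ χ z = ‖z‖⁻¹ • fderiv ℝ χ (‖z‖⁻¹ • z) := by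
      conv_lhs => rw [← h1]
      rw [fderiv_comp_smul]
    rw [h2, norm_smul, norm_inv, norm_norm, div_eq_inv_mul]
    gcongr
    refine hL _ ?_
    rw [mem_sphere_zero_iff_norm, norm_smul, norm_inv, norm_norm, inv_mul_cancel₀ hzn.ne']
  all_goals
    intro h
    have hw : 0 < ‖a / z ^ r‖ := norm_pos_iff.2 (div_ne_zero ha (pow_ne_zero r hz))
  · rw [hχ, Ne, Real.smoothTransition.zero_iff_nonpos, not_le, sub_pos, div_lt_iff₀ hw] at h
    linarith
  · rw [hχ, Ne, Real.smoothTransition.eq_one_iff_one_le, not_le, sub_lt_iff_lt_add,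
      ← sub_lt_iff_lt_add', lt_div_iff₀ hw] at h
    linarith

theorem re_sub_abs_im_le {w : ℂ} (h : w.re ≤ ‖w‖ / 2) : w.re - |w.im| ≤ -(1 / 4) * ‖w‖ := by
  have h1 : ‖w‖ ^ 2 = w.re ^ 2 + |w.im| ^ 2 := by
    rw [Complex.sq_norm, Complex.normSq_apply, sq_abs]; ring
  have h2 := norm_nonneg w
  have h3 := abs_nonneg w.im
  by_contra! h4
  nlinarith

/-- `η` is a differentiable function off `0`, of size `O(z)` and with bounded derivative. -/
def IsSmallTerm (η : ℂ → ℂ) : Prop :=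
  ∃ C : ℝ, 0 ≤ C ∧ ∀ᶠ z in 𝓝[≠] (0 : ℂ), DifferentiableAt ℝ η z ∧ ‖η z‖ ≤ C * ‖z‖ ∧
    ‖fderiv ℝ η z‖ ≤ C

theorem isSmallTerm_of_analyticAt {e : ℂ → ℂ} (he : AnalyticAt ℂ e 0) (he0 : e 0 = 0) :
    IsSmallTerm e := by
  have hr : AnalyticAt ℝ e 0 := he.restrictScalars
  have h1 : ∀ᶠ z in 𝓝 (0 : ℂ), ‖fderiv ℝ e z‖ ≤ ‖fderiv ℝ e 0‖ + 1 :=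
    hr.fderiv.continuousAt.norm.eventually_le_const (by simp)
  have h2 : ∀ᶠ z in 𝓝 (0 : ℂ), AnalyticAt ℝ e z := hr.eventually_analyticAt
  obtain ⟨K, hK⟩ := he.differentiableAt.isBigO_sub.bound
  refine ⟨max K (‖fderiv ℝ e 0‖ + 1), le_max_of_le_right (by positivity), ?_⟩
  filter_upwards [nhdsWithin_le_nhds h1, nhdsWithin_le_nhds h2, nhdsWithin_le_nhds hK]
    with z h3 h4 h5
  refine ⟨h4.differentiableAt, ?_, h3.trans (le_max_right _ _)⟩
  rw [he0, sub_zero, sub_zero] at h5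
  exact h5.trans (by gcongr; exact le_max_left _ _)

namespace IsSmallTerm

variable {η : ℂ → ℂ}

theorem smul (h : IsSmallTerm η) {κ : ℂ → ℝ} {L : ℝ} (hL : 0 ≤ L)
    (hκ : ∀ z, z ≠ 0 → DifferentiableAt ℝ κ z ∧ |κ z| ≤ 1 ∧ ‖fderiv ℝ κ z‖ ≤ L / ‖z‖) :
    IsSmallTerm fun z => κ z • η z := by
  obtain ⟨C, hC, h⟩ := h
  refine ⟨C + L * C, by positivity, ?_⟩
  filter_upwards [h, self_mem_nhdsWithin] with z ⟨h1, h2, h3⟩ hz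
  have hz : z ≠ 0 := hz
  have hzn : 0 < ‖z‖ := norm_pos_iff.2 hz
  obtain ⟨k1, k2, k3⟩ := hκ z hz
  refine ⟨k1.smul h1, ?_, ?_⟩
  · rw [norm_smul, Real.norm_eq_abs]
    calc |κ z| * ‖η z‖ ≤ 1 * (C * ‖z‖) := by gcongr
      _ ≤ (C + L * C) * ‖z‖ := by rw [one_mul]; gcongr; nlinarith [mul_nonneg hL hC]
  · rw [fderiv_fun_smul k1 h1]
    refine (norm_add_le _ _).trans (add_le_add ?_ ?_)
    · rw [norm_smul, Real.norm_eq_abs]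
      calc |κ z| * ‖fderiv ℝ η z‖ ≤ 1 * C := by gcongr
        _ = C := one_mul C
    · rw [ContinuousLinearMap.norm_smulRight_apply]
      calc ‖fderiv ℝ κ z‖ * ‖η z‖ ≤ L / ‖z‖ * (C * ‖z‖) := by gcongr
        _ = L * C := by field_simp

theorem comp (h : IsSmallTerm η) {g : ℂ → ℂ} (hg : IsSmallTerm g)
    (ht : Tendsto g (𝓝[≠] 0) (𝓝[≠] 0)) : IsSmallTerm (η ∘ g) := by
  obtain ⟨C, hC, h⟩ := h
  obtain ⟨K, hK, hg⟩ := hg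
  refine ⟨C * K, by positivity, ?_⟩
  filter_upwards [ht.eventually h, hg] with z ⟨h1, h2, h3⟩ ⟨g1, g2, g3⟩
  refine ⟨h1.comp z g1, ?_, ?_⟩
  · calc ‖η (g z)‖ ≤ C * (K * ‖z‖) := h2.trans (by gcongr)
      _ = _ := by ring
  · rw [fderiv_comp z h1 g1]
    exact (ContinuousLinearMap.opNorm_comp_le _ _).trans (by gcongr)

end IsSmallTerm

theorem IsParabolic.exists_solution_of_isSmallTerm {r : ℕ} (hr : 1 ≤ r) {a : ℂ} (ha : a ≠ 0)
    {f e η : ℂ → ℂ} (h : IsParabolic r a f e) (hη : IsSmallTerm η) {c : ℝ} (hc : 0 < c)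
    (hs : ∀ᶠ z in 𝓝[≠] (0 : ℂ), η z ≠ 0 →
      (a / z ^ r).re - |(a / z ^ r).im| ≤ -c * ‖a / z ^ r‖) {δ : ℝ} (hδ : 0 < δ) :
    ∃ u : ℂ → ℂ, ∀ᶠ z in 𝓝[≠] (0 : ℂ), DifferentiableAt ℝ u z ∧ ‖z ^ r * u z‖ ≤ δ ∧
      ‖z‖ ^ (r + 1) * ‖fderiv ℝ u z‖ ≤ δ ∧ u (f z) = u z - η z := by
  obtain ⟨C, hC, hp⟩ := h.exists_bound hr ha
  obtain ⟨K, hK, hη⟩ := hη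
  refine exists_small_solution (C := max C K) (e := e) hr ha hc (le_max_of_le_left hC) ?_ ?_ hδ
  · filter_upwards [hp] with z ⟨h1, h2, h3, h4, h5⟩
    refine ⟨h1, h2, h3, h4, h5.trans ?_⟩
    gcongr
    exact le_max_left _ _
  · filter_upwards [hη, hs] with z ⟨h1, h2, h3⟩ h4
    exact ⟨h1, h2.trans (by gcongr; exact le_max_right _ _), h3.trans (le_max_right _ _), h4⟩

theorem eventually_le_norm_div_pow {r : ℕ} (hr : 1 ≤ r) {a : ℂ} (ha : a ≠ 0) (M : ℝ) :
    ∀ᶠ z in 𝓝[≠] (0 : ℂ), M ≤ ‖a / z ^ r‖ := by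
  have h1 : Tendsto (fun z : ℂ => ‖z‖ ^ r * M) (𝓝 0) (𝓝 0) := by
    have : ContinuousAt (fun z : ℂ => ‖z‖ ^ r * M) 0 := by fun_prop
    simpa [ContinuousAt, show r ≠ 0 by omega] using this
  filter_upwards [nhdsWithin_le_nhds (h1.eventually_le_const (norm_pos_iff.2 ha)),
    self_mem_nhdsWithin] with z h2 hz
  have hz : 0 < ‖z‖ := norm_pos_iff.2 hz
  rw [norm_div, norm_pow, le_div_iff₀ (by positivity), mul_comm]
  exact h2

/-- A parabolic germ admits a small correction `u` of its approximate Fatou coordinate which is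
compatible with the dynamics on a full punctured neighbourhood of the origin. -/
theorem IsParabolic.exists_correction {r : ℕ} (hr : 1 ≤ r) {a : ℂ} (ha : a ≠ 0)
    {f e : ℂ → ℂ} (h : IsParabolic r a f e) {δ : ℝ} (hδ : 0 < δ) :
    ∃ u : ℂ → ℂ, ∀ᶠ z in 𝓝[≠] (0 : ℂ), DifferentiableAt ℝ u z ∧ ‖z ^ r * u z‖ ≤ δ ∧
      ‖z‖ ^ (r + 1) * ‖fderiv ℝ u z‖ ≤ δ ∧ u (f z) = u z - e z := by
  obtain ⟨χ, L, hL, hχ⟩ := exists_angular_cutoff r ha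
  obtain ⟨g, hg, hgf⟩ := h.exists_inverse
  have he := isSmallTerm_of_analyticAt h.analyticAt_err h.err_zero
  have hη₁ : IsSmallTerm fun z => χ z • e z := he.smul hL fun z hz => by
    obtain ⟨h1, h2, h3, h4, -⟩ := hχ z hz
    exact ⟨h1, abs_le.2 ⟨by linarith, h3⟩, h4⟩
  have hη₂ : IsSmallTerm ((fun z => (χ z - 1) • e z) ∘ g) := by
    refine (he.smul hL fun z hz => ?_).comp
      (isSmallTerm_of_analyticAt hg.analyticAt hg.map_zero) hg.tendsto
    obtain ⟨h1, h2, h3, h4, -⟩ := hχ z hz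
    exact ⟨h1.sub_const 1, abs_le.2 ⟨by linarith, by linarith⟩, by rwa [fderiv_sub_const]⟩
  obtain ⟨u₁, hu₁⟩ := h.exists_solution_of_isSmallTerm hr ha hη₁ (c := 1 / 4) (by norm_num)
    (by
      filter_upwards [self_mem_nhdsWithin] with z hz h1
      exact re_sub_abs_im_le ((hχ z hz).2.2.2.2.1 fun h0 => h1 (by simp [h0]))) (half_pos hδ)
  obtain ⟨C, -, hbd⟩ := hg.exists_bound hr (neg_ne_zero.2 ha)
  obtain ⟨u₂, hu₂⟩ := hg.exists_solution_of_isSmallTerm hr (neg_ne_zero.2 ha) hη₂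
    (c := 1 / 8) (by norm_num)
    (by
      filter_upwards [hbd, eventually_le_norm_div_pow hr (neg_ne_zero.2 ha) 40]
        with y ⟨_, hy0, hy1, hy2, _⟩ hy3 hy4
      have h1 : χ (g y) ≠ 1 := fun h1 => hy4 (by simp [h1])
      have h2 := (hχ (g y) hy0).2.2.2.2.2 h1
      have h3 := re_sub_abs_im_le (w := -a / g y ^ r) (by
        rw [neg_div, norm_neg, Complex.neg_re]; linarith)
      generalize -a / g y ^ r = A at *
      generalize -a / y ^ r = B at *
      have h4 : ‖A - B‖ ≤ 5 / 4 := by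
        rw [hy1, add_assoc, add_sub_cancel_left]
        refine (norm_add_le _ _).trans ?_
        rw [norm_one]
        linarith
      have h5 := (Complex.abs_re_le_norm (A - B)).trans h4
      have h6 := (Complex.abs_im_le_norm (A - B)).trans h4
      have h7 := norm_sub_norm_le B A
      rw [norm_sub_rev] at h7
      rw [Complex.sub_re, abs_le] at h5
      rw [Complex.sub_im] at h6
      have h8 := (abs_sub_abs_le_abs_sub A.im B.im).trans h6
      linarith [h5.1, h5.2]) (half_pos hδ)
  refine ⟨fun z => u₁ z + u₂ z, ?_⟩
  filter_upwards [hu₁, hu₂, h.tendsto.eventually hu₂, nhdsWithin_le_nhds hgf]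
    with z ⟨a1, a2, a3, a4⟩ ⟨b1, b2, b3, _⟩ ⟨_, _, _, b4⟩ h1
  refine ⟨a1.add b1, ?_, ?_, ?_⟩
  · rw [mul_add]
    exact (norm_add_le _ _).trans (by linarith)
  · rw [fderiv_fun_add a1 b1]
    calc _ ≤ ‖z‖ ^ (r + 1) * (‖fderiv ℝ u₁ z‖ + ‖fderiv ℝ u₂ z‖) := by
          gcongr; exact norm_add_le _ _
      _ ≤ δ := by rw [mul_add]; linarith
  · simp only [Function.comp_apply, h1, Complex.real_smul] at b4
    simp only [Complex.real_smul] at a4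
    push_cast at a4 b4
    rw [a4]
    linear_combination -b4

theorem exists_openPartialHomeomorph_id_add {v : ℂ → ℂ} (hv0 : v 0 = 0)
    (hv : ∀ᶠ z in 𝓝[≠] (0 : ℂ), DifferentiableAt ℝ v z ∧ ‖v z‖ ≤ 1 / 2 * ‖z‖ ∧
      ‖fderiv ℝ v z‖ ≤ 1 / 2) :
    ∃ E : OpenPartialHomeomorph ℂ ℂ, 0 ∈ E.source ∧ ∀ z, E z = z + v z := by
  obtain ⟨ρ, hρ, H⟩ := Metric.eventually_nhds_iff_ball.1 (eventually_nhdsWithin_iff.1 hv)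
  have hle : ∀ x ∈ Metric.ball (0 : ℂ) ρ, ‖v x‖ ≤ 1 / 2 * ‖x‖ := by
    intro x hx
    rcases eq_or_ne x 0 with rfl | hx0
    · simp [hv0]
    · exact (H x hx hx0).2.1
  have hlip : ∀ x ∈ Metric.ball (0 : ℂ) ρ, ∀ y ∈ Metric.ball (0 : ℂ) ρ,
      ‖v x - v y‖ ≤ 1 / 2 * ‖x - y‖ := by
    intro x hx y hy
    by_cases h0 : (0 : ℂ) ∈ segment ℝ y x
    · have h1 := dist_add_dist_of_mem_segment h0
      rw [dist_zero_right, dist_zero_left, dist_comm, dist_eq_norm] at h1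
      rw [← h1]
      refine (norm_sub_le _ _).trans ?_
      linarith [hle x hx, hle y hy]
    · have hsub : ∀ w ∈ segment ℝ y x, w ∈ Metric.ball (0 : ℂ) ρ ∧ w ≠ 0 := fun w hw =>
        ⟨(convex_ball (0 : ℂ) ρ).segment_subset hy hx hw, fun h => h0 (h ▸ hw)⟩
      exact Convex.norm_image_sub_le_of_norm_fderiv_le (𝕜 := ℝ)
        (fun w hw => (H w (hsub w hw).1 (hsub w hw).2).1)
        (fun w hw => (H w (hsub w hw).1 (hsub w hw).2).2.2) (convex_segment y x)
        (left_mem_segment ℝ y x) (right_mem_segment ℝ y x)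
  have happ : ApproximatesLinearOn (fun z => z + v z)
      (ContinuousLinearEquiv.refl ℝ ℂ : ℂ →L[ℝ] ℂ) (Metric.ball 0 ρ) (1 / 2 : NNReal) := by
    intro x hx y hy
    have h1 : x + v x - (y + v y) - (ContinuousLinearEquiv.refl ℝ ℂ : ℂ →L[ℝ] ℂ) (x - y) =
        v x - v y := by
      simp
      ring
    rw [h1]
    exact (hlip x hx y hy).trans_eq (by simp)
  refine ⟨happ.toOpenPartialHomeomorph _ _ (Or.inr ?_) Metric.isOpen_ball, ?_, fun z => rfl⟩
  · have : ‖((ContinuousLinearEquiv.refl ℝ ℂ).symm : ℂ →L[ℝ] ℂ)‖₊ = 1 :=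
      ContinuousLinearMap.nnnorm_id
    rw [this, inv_one]
    exact NNReal.half_lt_self one_ne_zero
  · exact Metric.mem_ball_self hρ

theorem exists_eq_of_pow_eq_pow {r : ℕ} (hr : 1 ≤ r) :
    ∃ ε : ℝ, 0 < ε ∧ ∀ z X Y : ℂ, z ≠ 0 → ‖X - z‖ ≤ ε * ‖z‖ → ‖Y - z‖ ≤ ε * ‖z‖ →
      X ^ r = Y ^ r → X = Y := by
  set Φ : ℂ × ℂ → ℂ := fun p => ∑ i ∈ Finset.range r, p.1 ^ i * p.2 ^ (r - 1 - i) with hΦ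
  have hc : Continuous Φ := by fun_prop
  have h1 : Φ (1, 1) ≠ 0 := by
    simp [hΦ]
    omega
  obtain ⟨ε, hε, H⟩ := Metric.eventually_nhds_iff.1 (hc.continuousAt.eventually_ne h1)
  refine ⟨ε / 2, by positivity, fun z X Y hz hX hY hXY => ?_⟩
  have hzn : 0 < ‖z‖ := norm_pos_iff.2 hz
  have hd : ∀ W : ℂ, ‖W - z‖ ≤ ε / 2 * ‖z‖ → dist (W / z) 1 < ε := by
    intro W hW
    rw [dist_eq_norm, show W / z - 1 = (W - z) / z by field_simp, norm_div]
    exact ((div_le_iff₀ hzn).2 hW).trans_lt (by linarith)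
  have h2 : Φ (X / z, Y / z) ≠ 0 := H (by
    rw [Prod.dist_eq]
    exact max_lt (hd X hX) (hd Y hY))
  have h3 : Φ (X / z, Y / z) * (X / z - Y / z) = 0 := by
    rw [hΦ, geom_sum₂_mul, div_pow, div_pow, hXY, sub_self]
  have h4 := sub_eq_zero.1 ((mul_eq_zero.1 h3).resolve_left h2)
  exact (div_left_inj' hz).1 h4

/-- The principal branch of `(1 + y) ^ (-1 / r)`. -/
noncomputable def invRoot (r : ℕ) (y : ℂ) : ℂ := (1 + y) ^ (-(r : ℂ)⁻¹)

theorem exists_invRoot_bound {r : ℕ} (hr : 1 ≤ r) :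
    ∃ M : ℝ, 0 ≤ M ∧ ∀ᶠ y in 𝓝 (0 : ℂ), DifferentiableAt ℂ (invRoot r) y ∧
      ‖invRoot r y - 1‖ ≤ M * ‖y‖ ∧ ‖deriv (invRoot r) y‖ ≤ M ∧ invRoot r y ^ r * (1 + y) = 1 := by
  have hr0 : (r : ℂ) ≠ 0 := by simp; omega
  have han : AnalyticAt ℂ (invRoot r) 0 := by
    refine AnalyticAt.cpow (by fun_prop) (by fun_prop) ?_
    simp
  have h0 : invRoot r 0 = 1 := by simp [invRoot]
  obtain ⟨K, hK⟩ := han.differentiableAt.isBigO_sub.bound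
  have hd : ∀ᶠ y in 𝓝 (0 : ℂ), ‖deriv (invRoot r) y‖ ≤ ‖deriv (invRoot r) 0‖ + 1 :=
    han.deriv.continuousAt.norm.eventually_le_const (by simp)
  have hne : ∀ᶠ y in 𝓝 (0 : ℂ), 1 + y ≠ 0 :=
    ContinuousAt.eventually_ne (by fun_prop) (by simp)
  refine ⟨max K (‖deriv (invRoot r) 0‖ + 1), le_max_of_le_right (by positivity), ?_⟩
  filter_upwards [han.eventually_analyticAt, hK, hd, hne] with y h1 h2 h3 h4
  refine ⟨h1.differentiableAt, ?_, h3.trans (le_max_right _ _), ?_⟩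
  · rw [h0, sub_zero] at h2
    exact h2.trans (by gcongr; exact le_max_left _ _)
  · rw [invRoot, ← Complex.cpow_nat_mul, mul_neg, mul_inv_cancel₀ hr0, Complex.cpow_neg_one,
      inv_mul_cancel₀ h4]

theorem div_mul_pow_of_pow_mul_eq_one {r : ℕ} {a w s ρ : ℂ} (ha : a ≠ 0) (hw : w ≠ 0)
    (h : ρ ^ r * (1 + w ^ r * s / a) = 1) : a / (w * ρ) ^ r = a / w ^ r + s := by
  have hρ : ρ ^ r ≠ 0 := left_ne_zero_of_mul_eq_one h
  have hw' : w ^ r ≠ 0 := pow_ne_zero r hw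
  rw [mul_pow]
  field_simp at h ⊢
  linear_combination -h

/-- The germ which is the unit translation in the coordinate `a / z ^ r`. -/
noncomputable def parabolicModel (r : ℕ) (a z : ℂ) : ℂ := z * invRoot r (z ^ r / a)

theorem exists_invRoot_perturbation {r : ℕ} (hr : 1 ≤ r) {a : ℂ} (ha : a ≠ 0) {κ : ℝ}
    (hκ : 0 < κ) :
    ∃ δ : ℝ, 0 < δ ∧ ∀ u : ℂ → ℂ, ∀ z, z ≠ 0 → DifferentiableAt ℝ u z → ‖z ^ r * u z‖ ≤ δ →
      ‖z‖ ^ (r + 1) * ‖fderiv ℝ u z‖ ≤ δ →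
      invRoot r (z ^ r * u z / a) ^ r * (1 + z ^ r * u z / a) = 1 ∧
      DifferentiableAt ℝ (fun z => z * (invRoot r (z ^ r * u z / a) - 1)) z ∧
      ‖z * (invRoot r (z ^ r * u z / a) - 1)‖ ≤ κ * ‖z‖ ∧
      ‖fderiv ℝ (fun z => z * (invRoot r (z ^ r * u z / a) - 1)) z‖ ≤ κ := by
  obtain ⟨M, hM, hb⟩ := exists_invRoot_bound hr
  obtain ⟨ρ, hρ, H⟩ := Metric.eventually_nhds_iff.1 hb
  have han : 0 < ‖a‖ := norm_pos_iff.2 ha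
  obtain ⟨δ, hδ, hδρ, hδκ⟩ : ∃ δ : ℝ, 0 < δ ∧ δ / ‖a‖ < ρ ∧ M * ((r + 2) * (δ / ‖a‖)) ≤ κ := by
    refine ⟨‖a‖ * min (ρ / 2) (κ / ((M + 1) * (r + 2))), by positivity, ?_, ?_⟩
    · rw [mul_div_cancel_left₀ _ han.ne']
      exact (min_le_left _ _).trans_lt (by linarith)
    · rw [mul_div_cancel_left₀ _ han.ne']
      calc M * ((r + 2) * min (ρ / 2) (κ / ((M + 1) * (r + 2))))
          ≤ (M + 1) * ((r + 2) * (κ / ((M + 1) * (r + 2)))) := by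
            gcongr
            · linarith
            · exact min_le_right _ _
        _ = κ := by field_simp
  refine ⟨δ, hδ, fun u z hz hu h1 h2 => ?_⟩
  have hzn : 0 < ‖z‖ := norm_pos_iff.2 hz
  set y : ℂ → ℂ := fun z => z ^ r * u z / a with hy
  have hyn : ‖y z‖ ≤ δ / ‖a‖ := by
    rw [hy, norm_div]
    gcongr
  obtain ⟨b1, b2, b3, b4⟩ := H (by rw [dist_zero_right]; exact hyn.trans_lt hδρ)
  have dp := (hasDerivAt_pow r z).complexToReal_fderiv
  have dy : HasFDerivAt y (a⁻¹ • (z ^ r • fderiv ℝ u z +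
      u z • ((r * z ^ (r - 1) : ℂ) • (1 : ℂ →L[ℝ] ℂ)))) z := by
    have := (dp.mul hu.hasFDerivAt).const_mul a⁻¹
    refine this.congr_of_eventuallyEq (Eventually.of_forall fun x => ?_)
    simp only [hy, Pi.mul_apply]
    ring
  have dP := (b1.hasDerivAt.sub_const 1).comp_hasFDerivAt z dy
  have dv := (hasFDerivAt_id z).mul dP
  have hdv : HasFDerivAt (fun z => z * (invRoot r (y z) - 1)) _ z := dv
  refine ⟨b4, hdv.differentiableAt, ?_, ?_⟩
  · rw [norm_mul, mul_comm]
    gcongr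
    refine b2.trans (le_trans ?_ hδκ)
    gcongr
    refine hyn.trans (le_mul_of_one_le_left (by positivity) ?_)
    have : (0 : ℝ) ≤ r := by positivity
    linarith
  · rw [hdv.fderiv]
    have h3 : ‖z‖ * ‖a⁻¹ • (z ^ r • fderiv ℝ u z +
        u z • ((r * z ^ (r - 1) : ℂ) • (1 : ℂ →L[ℝ] ℂ)))‖ ≤ (r + 1) * (δ / ‖a‖) := by
      obtain ⟨k, rfl⟩ : ∃ k, r = k + 1 := ⟨r - 1, by omega⟩
      rw [norm_mul, norm_pow] at h1
      calc _ ≤ ‖z‖ * (‖a‖⁻¹ * (‖z‖ ^ (k + 1) * ‖fderiv ℝ u z‖ +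
            ‖u z‖ * (((k + 1 : ℕ) : ℝ) * ‖z‖ ^ k * 1))) := by
            rw [norm_smul, norm_inv]
            gcongr
            refine (norm_add_le _ _).trans (add_le_add ?_ ?_)
            · rw [norm_smul, norm_pow]
            · rw [norm_smul, norm_smul, norm_mul, norm_pow, Complex.norm_natCast, norm_one]
              simp
        _ = ‖a‖⁻¹ * (‖z‖ ^ (k + 1 + 1) * ‖fderiv ℝ u z‖ +
            ((k + 1 : ℕ) : ℝ) * (‖z‖ ^ (k + 1) * ‖u z‖)) := by ring
        _ ≤ ‖a‖⁻¹ * (δ + ((k + 1 : ℕ) : ℝ) * δ) := by gcongr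
        _ = _ := by ring
    refine (norm_add_le _ _).trans (le_trans ?_ hδκ)
    calc _ ≤ ‖z‖ * (M * ‖a⁻¹ • (z ^ r • fderiv ℝ u z +
            u z • ((r * z ^ (r - 1) : ℂ) • (1 : ℂ →L[ℝ] ℂ)))‖) + M * (δ / ‖a‖) * 1 := by
          refine add_le_add ?_ ?_
          · rw [norm_smul, norm_smul]
            gcongr
            rfl
          · rw [norm_smul]
            gcongr
            · exact b2.trans (by gcongr)
            · exact ContinuousLinearMap.norm_id_le
      _ ≤ M * ((r + 1) * (δ / ‖a‖)) + M * (δ / ‖a‖) * 1 := by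
          rw [mul_left_comm]
          gcongr
      _ = _ := by ring

theorem IsParabolic.eventually_norm_sub_le {r : ℕ} {a : ℂ} {f e : ℂ → ℂ}
    (h : IsParabolic r a f e) {κ : ℝ} (hκ : 0 < κ) :
    ∀ᶠ z in 𝓝[≠] (0 : ℂ), ‖f z - z‖ ≤ κ * ‖z‖ := by
  have := (hasDerivAt_iff_isLittleO.1 h.hasDerivAt).bound hκ
  filter_upwards [nhdsWithin_le_nhds this] with z hz
  simpa [h.map_zero] using hz

/-- A parabolic germ is topologically conjugate to the model with the same coordinate. -/
theorem IsParabolic.germConj {r : ℕ} (hr : 1 ≤ r) {a : ℂ} (ha : a ≠ 0) {f e : ℂ → ℂ}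
    (h : IsParabolic r a f e) : GermConj f (parabolicModel r a) := by
  obtain ⟨ε, hε, hroot⟩ := exists_eq_of_pow_eq_pow hr
  obtain ⟨κ, hκ, hκ2, hκε⟩ : ∃ κ : ℝ, 0 < κ ∧ κ ≤ 1 / 2 ∧ 3 * κ ≤ ε :=
    ⟨min (1 / 2) (ε / 3), by positivity, min_le_left _ _, by
      linarith [min_le_right (1 / 2) (ε / 3)]⟩
  obtain ⟨δ, hδ, hpert⟩ := exists_invRoot_perturbation hr ha hκ
  obtain ⟨u, hu⟩ := h.exists_correction hr ha hδ
  set v : ℂ → ℂ := fun z => z * (invRoot r (z ^ r * u z / a) - 1) with hv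
  have hv0 : v 0 = 0 := by simp [hv]
  have hall : ∀ᶠ z in 𝓝[≠] (0 : ℂ), z ≠ 0 ∧ u (f z) = u z - e z ∧
      a / (z + v z) ^ r = a / z ^ r + u z ∧ DifferentiableAt ℝ v z ∧ ‖v z‖ ≤ κ * ‖z‖ ∧
      ‖fderiv ℝ v z‖ ≤ κ := by
    filter_upwards [hu, self_mem_nhdsWithin] with z ⟨h1, h2, h3, h4⟩ hz
    have hz : z ≠ 0 := hz
    obtain ⟨k1, k2, k3, k4⟩ := hpert u z hz h1 h2 h3
    refine ⟨hz, h4, ?_, k2, k3, k4⟩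
    rw [← div_mul_pow_of_pow_mul_eq_one ha hz k1]
    simp only [hv]
    ring_nf
  obtain ⟨E, hE, hEv⟩ := exists_openPartialHomeomorph_id_add hv0
    (hall.mono fun z ⟨_, _, _, h1, h2, h3⟩ =>
      ⟨h1, h2.trans (by gcongr), h3.trans hκ2⟩)
  have hE0 : E 0 = 0 := by rw [hEv, hv0, add_zero]
  refine ⟨E, hE, hE0, ?_⟩
  have hEt : Tendsto (fun z => z + v z) (𝓝[≠] 0) (𝓝[≠] 0) := by
    refine tendsto_nhdsWithin_iff.2 ⟨?_, ?_⟩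
    · have := (E.continuousAt hE).tendsto
      rw [hE0] at this
      exact (this.mono_left nhdsWithin_le_nhds).congr hEv
    · filter_upwards [hall] with z ⟨hz, _, _, _, h2, _⟩ h0
      have hzn : 0 < ‖z‖ := norm_pos_iff.2 hz
      rw [← neg_eq_of_add_eq_zero_right h0, norm_neg] at h2
      nlinarith
  have hmodel : ∀ᶠ x in 𝓝[≠] (0 : ℂ), a / parabolicModel r a x ^ r = a / x ^ r + 1 ∧
      ‖parabolicModel r a x - x‖ ≤ κ * ‖x‖ := by
    obtain ⟨M, hM, hb⟩ := exists_invRoot_bound hr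
    have ht : Tendsto (fun x : ℂ => x ^ r / a) (𝓝 0) (𝓝 0) := by
      have : ContinuousAt (fun x : ℂ => x ^ r / a) 0 := by fun_prop
      simpa [ContinuousAt, show r ≠ 0 by omega] using this
    have hs : ∀ᶠ y in 𝓝 (0 : ℂ), M * ‖y‖ ≤ κ :=
      (show ContinuousAt (fun y : ℂ => M * ‖y‖) 0 by fun_prop).eventually_le_const (by simpa)
    filter_upwards [nhdsWithin_le_nhds (ht.eventually hb), nhdsWithin_le_nhds (ht.eventually hs),
      self_mem_nhdsWithin] with x ⟨_, h2, _, h4⟩ h5 hx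
    refine ⟨div_mul_pow_of_pow_mul_eq_one ha hx (by rwa [mul_one]), ?_⟩
    rw [parabolicModel, show x * invRoot r (x ^ r / a) - x = (invRoot r (x ^ r / a) - 1) * x by
      ring, norm_mul]
    gcongr
    exact h2.trans h5
  have hmain : ∀ᶠ z in 𝓝[≠] (0 : ℂ), E (f z) = parabolicModel r a (E z) := by
    filter_upwards [hall, h.tendsto.eventually hall, h.coord, h.eventually_norm_sub_le hκ,
      hEt.eventually hmodel] with z ⟨hz, z1, z2, _, z4, _⟩ ⟨_, _, f2, _, f4, _⟩ ⟨_, c1⟩ c2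
      ⟨m1, m2⟩
    rw [hEv, hEv]
    have hzn : 0 < ‖z‖ := norm_pos_iff.2 hz
    refine hroot z _ _ hz ?_ ?_ (inv_injective (mul_left_cancel₀ ha ?_))
    · have n1 : ‖f z‖ ≤ 2 * ‖z‖ := by
        have := norm_le_norm_add_norm_sub' (f z) z
        nlinarith
      rw [show f z + v (f z) - z = (f z - z) + v (f z) by ring]
      refine (norm_add_le _ _).trans ?_
      nlinarith
    · have n1 : ‖z + v z‖ ≤ 2 * ‖z‖ := by
        have := norm_add_le z (v z)
        nlinarith
      rw [show parabolicModel r a (z + v z) - z =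
        (parabolicModel r a (z + v z) - (z + v z)) + v z by ring]
      refine (norm_add_le _ _).trans ?_
      nlinarith
    · rw [← div_eq_mul_inv, ← div_eq_mul_inv, f2, m1, z2, c1, z1]
      ring
  filter_upwards [eventually_nhdsWithin_iff.1 hmain] with z hz
  rcases eq_or_ne z 0 with rfl | h0
  · rw [h.map_zero, hE0]
    simp [parabolicModel]
  · exact hz h0

theorem germConj_parabolicModel {r : ℕ} (hr : 1 ≤ r) {a b : ℂ} (ha : a ≠ 0) (hb : b ≠ 0) :
    GermConj (parabolicModel r a) (parabolicModel r b) := by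
  obtain ⟨l, hl⟩ := IsAlgClosed.exists_pow_nat_eq (b / a) (by omega : 0 < r)
  have hl0 : l ≠ 0 := by
    rintro rfl
    rw [zero_pow (by omega)] at hl
    exact div_ne_zero hb ha hl.symm
  refine GermConj.of_linear hl0 fun z => ?_
  have : (l * z) ^ r / b = z ^ r / a := by
    rw [mul_pow, hl]
    field_simp
  rw [parabolicModel, parabolicModel, this, mul_assoc]

/-- A germ tangent to the identity in factored form is conjugate to any parabolic model of the
same multiplicity. -/
theorem germConj_parabolicModel_of_eventuallyEq {r : ℕ} (hr : 1 ≤ r) {f m : ℂ → ℂ}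
    (hm : AnalyticAt ℂ m 0) (hm0 : m 0 ≠ 0) (hf : ∀ᶠ z in 𝓝 (0 : ℂ), f z = z + z ^ (r + 1) * m z) :
    GermConj f (parabolicModel r 1) := by
  obtain ⟨e, he⟩ := isParabolic_of_eventuallyEq hr hm hm0 hf
  have hr0 : (r : ℂ) ≠ 0 := by simp; omega
  have ha : -(1 / (r * m 0)) ≠ 0 := neg_ne_zero.2 (one_div_ne_zero (mul_ne_zero hr0 hm0))
  exact (he.germConj hr ha).trans (germConj_parabolicModel hr ha one_ne_zero)

theorem exists_factor_of_iteratedDeriv {f : ℂ → ℂ} {r : ℕ} (hf : AnalyticAt ℂ f 0)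
    (hr : 1 ≤ r) (hf0 : f 0 = 0) (hd1 : deriv f 0 = 1)
    (hvanish : ∀ k, 2 ≤ k → k ≤ r → iteratedDeriv k f 0 = 0)
    (hlead : iteratedDeriv (r + 1) f 0 ≠ 0) :
    ∃ m : ℂ → ℂ, AnalyticAt ℂ m 0 ∧ m 0 ≠ 0 ∧
      ∀ᶠ z in 𝓝 (0 : ℂ), f z = z + z ^ (r + 1) * m z := by
  obtain ⟨F, hF, h⟩ := hf.exists_eventuallyEq_sum_add_pow_mul (r + 2)
  refine ⟨fun z => iteratedDeriv (r + 1) f 0 / (r + 1).factorial + z * F z, by fun_prop, ?_, ?_⟩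
  · simpa using ⟨hlead, Nat.factorial_ne_zero _⟩
  · filter_upwards [h] with z hz
    have h1 : ∑ i ∈ Finset.range (r + 1), (z ^ i / i.factorial) • iteratedDeriv i f 0 = z := by
      rw [Finset.sum_eq_single 1]
      · simp [hd1]
      · intro i hi hi1
        rcases Nat.eq_zero_or_pos i with rfl | hi0
        · simp [hf0]
        · rw [hvanish i (by omega) (by have := Finset.mem_range.1 hi; omega), smul_zero]
      · simp
        omega
    rw [hz, Finset.sum_range_succ, h1, smul_eq_mul, smul_eq_mul]
    ring

/-- **Camacho's theorem.** A one-dimensional holomorphic local dynamical system tangent to the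
identity with multiplicity `r+1 ≥ 2` at the fixed point is topologically locally conjugated to
the map `z ↦ z - z^{r+1}`. -/
theorem camacho_topological_normal_form
    (f : ℂ → ℂ) (U : Set ℂ) (hU : IsOpen U) (h0 : (0 : ℂ) ∈ U)
    (hf : DifferentiableOn ℂ f U) (hf0 : f 0 = 0) (r : ℕ) (hr : 1 ≤ r)
    (hd1 : deriv f 0 = 1)
    (hvanish : ∀ k, 2 ≤ k → k ≤ r → iteratedDeriv k f 0 = 0)
    (hlead : iteratedDeriv (r + 1) f 0 ≠ 0) :
    TopLocallyConj f U (fun z => z - z ^ (r + 1)) Set.univ := by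
  have hfa : AnalyticAt ℂ f 0 := hf.analyticAt (hU.mem_nhds h0)
  obtain ⟨m, hm, hm0, hfm⟩ := exists_factor_of_iteratedDeriv hfa hr hf0 hd1 hvanish hlead
  have hgm : ∀ᶠ z in 𝓝 (0 : ℂ), z - z ^ (r + 1) = z + z ^ (r + 1) * (-1) :=
    Eventually.of_forall fun z => by ring
  have h₁ := germConj_parabolicModel_of_eventuallyEq hr hm hm0 hfm
  have h₂ := germConj_parabolicModel_of_eventuallyEq hr (analyticAt_const (v := (-1 : ℂ)))
    (by norm_num) hgm
  exact (h₁.trans (h₂.symm (by fun_prop) (by simp))).topLocallyConj hU h0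
end

section
/- Let f be a holomorphic local dynamical system at 0 ∈ ℂ tangent to the identity with multiplicity r+1 ≥ 2. Then f is formally conjugated to the map g(z) = z − z^{r+1} + β z^{2r+1}, where β ∈ ℂ is a formal (and holomorphic) invariant given by β = (1/2πi) ∮_γ dz/(z − f(z)), the integral being taken over a small positive loop γ about the origin. Moreover two maps of the form z − z^{r+1} + β z^{2r+1} and z − z^{r+1} + β' z^{2r+1} with β ≠ β' are not formally conjugated, and β is invariant under holomorphic local conjugation. -/
open Set Filter Topology

/-- `φ` is a biholomorphism from `W₁` onto `W₂` fixing `0` which conjugates the holomorphic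
local dynamical system `f₁` (defined on `U₁`) to `f₂` (defined on `U₂`). -/
def IsHolConjVia (f₁ : ℂ → ℂ) (U₁ : Set ℂ) (f₂ : ℂ → ℂ) (U₂ : Set ℂ)
    (φ : ℂ → ℂ) (W₁ W₂ : Set ℂ) : Prop :=
  IsOpen W₁ ∧ IsOpen W₂ ∧ (0 : ℂ) ∈ W₁ ∧ (0 : ℂ) ∈ W₂ ∧ W₁ ⊆ U₁ ∧ W₂ ⊆ U₂ ∧
    DifferentiableOn ℂ φ W₁ ∧ Set.BijOn φ W₁ W₂ ∧
    (∃ ψ : ℂ → ℂ, DifferentiableOn ℂ ψ W₂ ∧ Set.EqOn (ψ ∘ φ) id W₁) ∧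
    φ 0 = 0 ∧ ∀ z ∈ W₁, f₁ z ∈ W₁ → φ (f₁ z) = f₂ (φ z)

/-- `f₁` and `f₂` are holomorphically locally conjugated at `0`. -/
def HolLocallyConj (f₁ : ℂ → ℂ) (U₁ : Set ℂ) (f₂ : ℂ → ℂ) (U₂ : Set ℂ) : Prop :=
  ∃ φ W₁ W₂, IsHolConjVia f₁ U₁ f₂ U₂ φ W₁ W₂

/-- Two formal power series without constant term (seen as formal multilinear series in one
complex variable) are formally conjugated if there is a formally invertible series `Φ`
(no constant term, non-vanishing linear term) with `Φ ∘ F = G ∘ Φ`. -/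
def FormallyConj (F G : FormalMultilinearSeries ℂ ℂ ℂ) : Prop :=
  ∃ Φ : FormalMultilinearSeries ℂ ℂ ℂ,
    Φ.coeff 0 = 0 ∧ Φ.coeff 1 ≠ 0 ∧ Φ.comp F = G.comp Φ

/-- The formal power series of the map `g(z) = z - z^{r+1} + β z^{2r+1}`. -/
noncomputable def gSeries (r : ℕ) (β : ℂ) : FormalMultilinearSeries ℂ ℂ ℂ :=
  FormalMultilinearSeries.ofScalars ℂ
    (fun n => if n = 1 then 1 else if n = r + 1 then -1 else if n = 2 * r + 1 then β else 0)

section FormalSeries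
open PowerSeries

theorem coeff_subst_eq_sum_range {b : ℂ⟦X⟧} (hb : constantCoeff b = 0) (f : ℂ⟦X⟧)
    {n N : ℕ} (hn : n < N) :
    coeff n (f.subst b) = ∑ k ∈ Finset.range N, coeff k f * coeff n (b ^ k) := by
  rw [coeff_subst' (HasSubst.of_constantCoeff_zero' hb)]
  simp only [smul_eq_mul]
  refine finsum_eq_sum_of_support_subset _ fun k hk => ?_
  by_contra hkN
  refine hk ?_
  have hXb : (X : ℂ⟦X⟧) ∣ b := X_dvd_iff.2 hb
  have : coeff n (b ^ k) = 0 :=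
    X_pow_dvd_iff.1 (pow_dvd_pow_of_dvd hXb k) n (by simp at hkN; omega)
  simp [this]

theorem X_pow_mul_subst {b : ℂ⟦X⟧} (hb : constantCoeff b = 0) (f : ℂ⟦X⟧) (n : ℕ) :
    (X ^ n * f).subst b = b ^ n * f.subst b := by
  have h := HasSubst.of_constantCoeff_zero' hb
  rw [subst_mul h, subst_pow h, subst_X h]

theorem constantCoeff_subst_self {b : ℂ⟦X⟧} (hb : constantCoeff b = 0) (f : ℂ⟦X⟧) :
    constantCoeff (f.subst b) = constantCoeff f := by
  rw [← coeff_zero_eq_constantCoeff_apply, coeff_subst_eq_sum_range hb f zero_lt_one]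
  simp

/-- First-order Taylor formula. -/
theorem X_pow_dvd_taylor {h : ℂ⟦X⟧} {n : ℕ} (hn : 0 < n) (hh : X ^ n ∣ h) (f : ℂ⟦X⟧) :
    X ^ (2 * n) ∣ f.subst (X - h) - f + d⁄dX ℂ f * h := by
  have hXh : (X : ℂ⟦X⟧) ∣ h := (dvd_pow_self X hn.ne').trans hh
  have hb : constantCoeff (X - h) = 0 := by simp [X_dvd_iff.1 hXh]
  have hs := HasSubst.of_constantCoeff_zero' hb
  set N := 2 * n
  obtain ⟨g, hg⟩ : X ^ N ∣ f - (trunc N f : ℂ⟦X⟧) := by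
    rw [X_pow_dvd_iff]
    intro m hm
    simp [Polynomial.coeff_coe, coeff_trunc, hm]
  obtain ⟨k, hk⟩ := Polynomial.binomExpansion
    ((trunc N f).map (algebraMap ℂ ℂ⟦X⟧)) X (-h)
  have hp (p : Polynomial ℂ) (b : ℂ⟦X⟧) (hs : HasSubst b) :
      (p.map (algebraMap ℂ ℂ⟦X⟧)).eval b = (p : ℂ⟦X⟧).subst b := by
    rw [subst_coe hs, Polynomial.eval_map_algebraMap]
  rw [← sub_eq_add_neg, Polynomial.derivative_map, hp _ _ hs, hp _ _ HasSubst.X',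
    hp _ _ HasSubst.X', X_subst, X_subst, ← derivative_coe] at hk
  rw [sub_eq_iff_eq_add] at hg
  have h1 : X ^ N ∣ k * (-h) ^ 2 := by
    rw [neg_sq]
    refine Dvd.dvd.mul_left ?_ k
    have := pow_dvd_pow_of_dvd hh 2
    rwa [← pow_mul, mul_comm n 2] at this
  have h2 : X ^ N ∣ (X - h) ^ N * g.subst (X - h) :=
    Dvd.dvd.mul_right (pow_dvd_pow_of_dvd (X_dvd_iff.2 hb) N) _
  have h3 : X ^ N ∣ d⁄dX ℂ (X ^ N * g) * h := by
    rw [Derivation.leibniz, derivative_pow]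
    have : X ^ N ∣ (X : ℂ⟦X⟧) ^ (N - 1) * h := by
      obtain ⟨M, hM⟩ : ∃ M, N = M + 1 := ⟨N - 1, by omega⟩
      rw [hM]
      simpa [pow_succ] using mul_dvd_mul_left (X ^ M) hXh
    obtain ⟨t, ht⟩ := this
    refine ⟨d⁄dX ℂ g * h + g * N * t, ?_⟩
    simp only [smul_eq_mul, derivative_X]
    linear_combination (g * N) * ht
  have h4 : f.subst (X - h) = (trunc N f : ℂ⟦X⟧).subst (X - h) + (X - h) ^ N * g.subst (X - h) := by
    conv_lhs => rw [hg]
    rw [subst_add hs, X_pow_mul_subst hb, add_comm]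
  have h5 : d⁄dX ℂ f = d⁄dX ℂ (X ^ N * g) + d⁄dX ℂ (trunc N f : ℂ⟦X⟧) := by
    conv_lhs => rw [hg]
    rw [map_add]
  have : f.subst (X - h) - f + d⁄dX ℂ f * h = k * (-h) ^ 2 + (X - h) ^ N * g.subst (X - h)
      + d⁄dX ℂ (X ^ N * g) * h - X ^ N * g := by
    rw [h4, h5]
    linear_combination hk - hg
  rw [this]
  exact dvd_sub (dvd_add (dvd_add h1 h2) h3) (dvd_mul_right _ _)

theorem coeff_derivative_mul_inv_pow {v : ℂ⟦X⟧} (hv : constantCoeff v ≠ 0) (m : ℕ) :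
    coeff m (d⁄dX ℂ (X * v) * v⁻¹ ^ (m + 1)) = if m = 0 then 1 else 0 := by
  have hvi : v * v⁻¹ = 1 := PowerSeries.mul_inv_cancel v hv
  have e : d⁄dX ℂ (X * v) * v⁻¹ ^ (m + 1) = v⁻¹ ^ m + X * (d⁄dX ℂ v * v⁻¹ ^ (m + 1)) := by
    rw [Derivation.leibniz]
    simp only [smul_eq_mul, derivative_X]
    linear_combination v⁻¹ ^ m * hvi
  rcases m with _ | m
  · rw [e]; simp
  · have e' : X * d⁄dX ℂ (v⁻¹ ^ (m + 1)) =
        -((m + 1 : ℕ) : ℂ⟦X⟧) * (X * (d⁄dX ℂ v * v⁻¹ ^ (m + 1 + 1))) := by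
      rw [derivative_pow, derivative_inv']
      simp only [Nat.add_sub_cancel]
      push_cast
      ring
    have e2 := congrArg (coeff (m + 1)) e'
    rw [← map_natCast (C (R := ℂ)), ← map_neg, coeff_C_mul, coeff_succ_X_mul, coeff_derivative] at e2
    rw [e, map_add, if_neg (Nat.succ_ne_zero m)]
    have hm : ((m + 1 : ℕ) : ℂ) ≠ 0 := Nat.cast_ne_zero.2 (Nat.succ_ne_zero m)
    refine mul_left_cancel₀ hm ?_
    push_cast at *
    linear_combination e2

/-- The residue of `(z - f z)⁻¹` is invariant under formal conjugation. -/
theorem residue_eq_of_subst_eq {Φ u k : ℂ⟦X⟧} {r : ℕ} (h0 : constantCoeff Φ = 0)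
    (h1 : coeff 1 Φ ≠ 0) (hu : constantCoeff u ≠ 0)
    (hconj : Φ.subst (X - X ^ (r + 1) * u) = (X - k).subst Φ) :
    ∃ w : ℂ⟦X⟧, constantCoeff w ≠ 0 ∧ k = X ^ (r + 1) * w ∧ coeff r w⁻¹ = coeff r u⁻¹ := by
  have hΦ := HasSubst.of_constantCoeff_zero' h0
  obtain ⟨v, rfl⟩ := X_dvd_iff.2 h0
  have hv : constantCoeff v ≠ 0 := by simpa using h1
  have hvi : v * v⁻¹ = 1 := PowerSeries.mul_inv_cancel v hv
  set Φ := X * v with hΦv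
  have hD : constantCoeff (d⁄dX ℂ Φ) ≠ 0 := by
    rw [← coeff_zero_eq_constantCoeff_apply, coeff_derivative]
    simpa using h1
  obtain ⟨S, hS⟩ := X_pow_dvd_taylor r.succ_pos (dvd_mul_right (X ^ (r + 1)) u) Φ
  rw [Nat.succ_eq_add_one] at hS
  set t := d⁄dX ℂ Φ * u - X ^ (r + 1) * S with ht
  have hkt : k.subst Φ = X ^ (r + 1) * t := by
    rw [hconj, subst_sub hΦ, subst_X hΦ] at hS
    linear_combination -hS
  have ht0 : constantCoeff t ≠ 0 := by
    simpa [ht] using ⟨hD, hu⟩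
  have hk0 : k ≠ 0 := by
    rintro rfl
    rw [← coe_substAlgHom hΦ, map_zero] at hkt
    have : t = 0 := by
      simpa [X_ne_zero] using hkt.symm
    exact ht0 (by simp [this])
  obtain ⟨w, hw, hw0⟩ : ∃ w, k = X ^ k.order.toNat * w ∧ constantCoeff w ≠ 0 :=
    ⟨divXPowOrder k, X_pow_order_mul_divXPowOrder.symm,
      constantCoeff_divXPowOrder_eq_zero_iff.not.2 hk0⟩
  set m := k.order.toNat
  have hws : constantCoeff (w.subst Φ) ≠ 0 := by rwa [constantCoeff_subst_self h0]
  have hkt' : X ^ m * (v ^ m * w.subst Φ) = X ^ (r + 1) * t := by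
    rw [← hkt, hw, X_pow_mul_subst h0, hΦv]; ring
  have hm : m = r + 1 := by
    have o {a : ℂ⟦X⟧} (ha : constantCoeff a ≠ 0) (n : ℕ) : (X ^ n * a).order = (n : ℕ∞) := by
      rw [order_mul, order_X_pow, order_zero_of_unit, add_zero]
      rw [isUnit_iff_constantCoeff]
      exact isUnit_iff_ne_zero.2 ha
    have := congrArg order hkt'
    rw [o (by simp [hv, hws]), o ht0] at this
    exact_mod_cast this
  rw [hm] at hkt' hw
  refine ⟨w, hw0, hw, ?_⟩
  have hvt : v ^ (r + 1) * w.subst Φ = t := by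
    exact mul_left_cancel₀ (pow_ne_zero _ X_ne_zero) hkt'
  have hti : t * t⁻¹ = 1 := PowerSeries.mul_inv_cancel t ht0
  have hui : u * u⁻¹ = 1 := PowerSeries.mul_inv_cancel u hu
  have hwi : w * w⁻¹ = 1 := PowerSeries.mul_inv_cancel w hw0
  have hwis : w.subst Φ * w⁻¹.subst Φ = 1 := by
    rw [← subst_mul hΦ, hwi, ← coe_substAlgHom hΦ, map_one]
  have e1 : coeff r (d⁄dX ℂ Φ * v⁻¹ ^ (r + 1) * w⁻¹.subst Φ) = coeff r u⁻¹ := by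
    rw [← sub_eq_zero, ← map_sub]
    refine X_pow_dvd_iff.1 (Dvd.intro (S * u⁻¹ * t⁻¹) ?_ : X ^ (r + 1) ∣ _) r (Nat.lt_succ_self r)
    have hvv : v⁻¹ ^ (r + 1) * v ^ (r + 1) = 1 := by rw [← mul_pow, mul_comm, hvi, one_pow]
    have : v⁻¹ ^ (r + 1) * w⁻¹.subst Φ = t⁻¹ := by
      calc _ = v⁻¹ ^ (r + 1) * w⁻¹.subst Φ * (t * t⁻¹) := by rw [hti, mul_one]
        _ = (v⁻¹ ^ (r + 1) * v ^ (r + 1)) * (w.subst Φ * w⁻¹.subst Φ) * t⁻¹ := by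
          rw [← hvt]; ring
        _ = t⁻¹ := by rw [hvv, hwis]; ring
    linear_combination (-d⁄dX ℂ Φ) * this + d⁄dX ℂ Φ * t⁻¹ * hui - u⁻¹ * hti + u⁻¹ * t⁻¹ * ht
  rw [← e1]
  have e2 : X ^ (r + 1) ∣
      w⁻¹.subst Φ - ∑ j ∈ Finset.range (r + 1), C (coeff j w⁻¹) * Φ ^ j := by
    rw [X_pow_dvd_iff]
    intro m hm
    rw [map_sub, coeff_subst_eq_sum_range h0 _ hm, map_sum, sub_eq_zero]
    simp only [coeff_C_mul]
  have e3 : coeff r (d⁄dX ℂ Φ * v⁻¹ ^ (r + 1) * w⁻¹.subst Φ) =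
      coeff r (d⁄dX ℂ Φ * v⁻¹ ^ (r + 1) *
        ∑ j ∈ Finset.range (r + 1), C (coeff j w⁻¹) * Φ ^ j) := by
    rw [← sub_eq_zero, ← map_sub, ← mul_sub]
    exact X_pow_dvd_iff.1 (e2.mul_left _) r (Nat.lt_succ_self r)
  have e4 : ∀ j ∈ Finset.range (r + 1), coeff r (d⁄dX ℂ Φ * v⁻¹ ^ (r + 1) *
      (C (coeff j w⁻¹) * Φ ^ j)) = if j = r then coeff j w⁻¹ else 0 := by
    intro j hj
    obtain ⟨i, rfl⟩ : ∃ i, r = i + j := ⟨r - j, by simp at hj; omega⟩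
    have hvj : v⁻¹ ^ j * v ^ j = 1 := by rw [← mul_pow, mul_comm, hvi, one_pow]
    have : d⁄dX ℂ Φ * v⁻¹ ^ (i + j + 1) * (C (coeff j w⁻¹) * Φ ^ j) =
        C (coeff j w⁻¹) * (X ^ j * (d⁄dX ℂ Φ * v⁻¹ ^ (i + 1))) := by
      have hΦj : Φ ^ j = X ^ j * v ^ j := by rw [hΦv, mul_pow]
      rw [hΦj]
      linear_combination (d⁄dX ℂ Φ * v⁻¹ ^ (i + 1) * C (coeff j w⁻¹) * X ^ j) * hvj
    rw [this, coeff_C_mul, coeff_X_pow_mul, hΦv, coeff_derivative_mul_inv_pow hv]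
    by_cases hi : i = 0 <;> simp [hi]
  rw [e3, Finset.mul_sum, map_sum, Finset.sum_congr rfl e4]
  simp

theorem residue_normalForm {r : ℕ} (hr : 1 ≤ r) (β : ℂ) :
    coeff r (1 - C β * X ^ r : ℂ⟦X⟧)⁻¹ = β := by
  have hr0 : r ≠ 0 := by omega
  set w : ℂ⟦X⟧ := 1 - C β * X ^ r with hw
  have h0 : constantCoeff w = 1 := by simp [hw, hr0]
  have hwi : w⁻¹ = 1 + C β * (X ^ r * w⁻¹) := by
    have := PowerSeries.mul_inv_cancel w (by simp [h0])
    linear_combination this - w⁻¹ * hw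
  rw [hwi, map_add, coeff_C_mul, coeff_X_pow_mul', coeff_one]
  simp [hr0, h0]

/-- The failure of `Φ` to conjugate `X - X ^ (r + 1) * u` to `X - X ^ (r + 1) + β X ^ (2 r + 1)`. -/
noncomputable def conjDefect (u : ℂ⟦X⟧) (r : ℕ) (β : ℂ) (Φ : ℂ⟦X⟧) : ℂ⟦X⟧ :=
  Φ.subst (X - X ^ (r + 1) * u) - (Φ - Φ ^ (r + 1) + C β * Φ ^ (2 * r + 1))

theorem X_dvd_sub_C_constantCoeff (f : ℂ⟦X⟧) : X ∣ f - C (constantCoeff f) := by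
  simp [X_dvd_iff]

theorem conjDefect_add_monomial (u : ℂ⟦X⟧) {r : ℕ} (hr : 1 ≤ r) (β c : ℂ) {Φ : ℂ⟦X⟧} (i : ℕ)
    (h0 : constantCoeff Φ = 0) (h1 : coeff 1 Φ ^ r = constantCoeff u) :
    X ^ (r + (i + 2) + 1) ∣ conjDefect u r β (Φ + C c * X ^ (i + 2)) - conjDefect u r β Φ -
      C (c * ((r : ℂ) - 1 - i) * constantCoeff u) * X ^ (r + (i + 2)) := by
  obtain ⟨s, rfl⟩ : ∃ s, r = s + 1 := ⟨r - 1, by omega⟩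
  obtain ⟨v, rfl⟩ := X_dvd_iff.2 h0
  have hv : constantCoeff v ^ (s + 1) = constantCoeff u := by simpa using h1
  have hF : constantCoeff (X - X ^ (s + 1 + 1) * u) = 0 := by simp
  have hs := HasSubst.of_constantCoeff_zero' hF
  obtain ⟨A, hA⟩ := Polynomial.powAddExpansion (1 : ℂ⟦X⟧) (-(X ^ (s + 1) * u)) (i + 2)
  obtain ⟨B, hB⟩ := Polynomial.powAddExpansion v (C c * X ^ (i + 1)) (s + 1 + 1)
  obtain ⟨D, hD⟩ := sub_dvd_pow_sub_pow (v + C c * X ^ (i + 1)) v (2 * (s + 1) + 1)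
  obtain ⟨u', hu'⟩ := X_dvd_sub_C_constantCoeff u
  obtain ⟨v', hv'⟩ := X_dvd_sub_C_constantCoeff (v ^ (s + 1))
  rw [map_pow, hv] at hv'
  have e1 : (C c * X ^ (i + 2) : ℂ⟦X⟧).subst (X - X ^ (s + 1 + 1) * u) =
      C c * (X ^ (i + 2) * (1 + -(X ^ (s + 1) * u)) ^ (i + 2)) := by
    rw [subst_mul hs, subst_pow hs, subst_X hs, ← mul_pow,
      show (X : ℂ⟦X⟧) - X ^ (s + 1 + 1) * u = X * (1 + -(X ^ (s + 1) * u)) by ring]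
    congr 1
    exact subst_C _
  have e2 (n : ℕ) : (X * v + C c * X ^ (i + 2)) ^ n = X ^ n * (v + C c * X ^ (i + 1)) ^ n := by
    rw [← mul_pow]; ring
  simp only [conjDefect]
  rw [subst_add hs, e1, e2, e2, mul_pow, mul_pow, hA, hB, sub_eq_iff_eq_add.1 hD]
  simp only [one_pow, Nat.add_sub_cancel]
  refine ⟨C c * (A * X ^ s * u ^ 2 - ((i + 2 : ℕ) : ℂ⟦X⟧) * u'
    + ((s + 1 + 1 : ℕ) : ℂ⟦X⟧) * v' + B * X ^ i * C c - C β * X ^ s * D), ?_⟩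
  simp only [map_mul, map_sub, map_natCast, map_one]
  push_cast
  linear_combination (C c * X ^ (s + 1 + (i + 2)) * (-(i + 2 : ℂ⟦X⟧))) * hu' +
    (C c * X ^ (s + 1 + (i + 2)) * (s + 1 + 1 : ℂ⟦X⟧)) * hv'

theorem X_pow_dvd_conjDefect_sub (u : ℂ⟦X⟧) (r : ℕ) (β : ℂ) {Φ Ψ : ℂ⟦X⟧} {n : ℕ}
    (h : X ^ n ∣ Φ - Ψ) : X ^ n ∣ conjDefect u r β Φ - conjDefect u r β Ψ := by
  have hF : constantCoeff (X - X ^ (r + 1) * u) = 0 := by simp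
  have hs := HasSubst.of_constantCoeff_zero' hF
  have h1 : X ^ n ∣ Φ.subst (X - X ^ (r + 1) * u) - Ψ.subst (X - X ^ (r + 1) * u) := by
    obtain ⟨g, hg⟩ := h
    rw [← subst_sub hs, hg, X_pow_mul_subst hF]
    exact (pow_dvd_pow_of_dvd (X_dvd_iff.2 hF) n).mul_right _
  have h2 (m : ℕ) : X ^ n ∣ Φ ^ m - Ψ ^ m := h.trans (sub_dvd_pow_sub_pow _ _ _)
  have : conjDefect u r β Φ - conjDefect u r β Ψ =
      Φ.subst (X - X ^ (r + 1) * u) - Ψ.subst (X - X ^ (r + 1) * u) - (Φ - Ψ)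
      + (Φ ^ (r + 1) - Ψ ^ (r + 1)) - C β * (Φ ^ (2 * r + 1) - Ψ ^ (2 * r + 1)) := by
    simp only [conjDefect]; ring
  rw [this]
  exact dvd_sub (dvd_add (dvd_sub h1 h) (h2 _)) ((h2 _).mul_left _)

theorem X_pow_succ_dvd_of_coeff {f : ℂ⟦X⟧} {n : ℕ} (hf : X ^ n ∣ f) (hc : coeff n f = 0) :
    X ^ (n + 1) ∣ f := by
  rw [X_pow_dvd_iff] at hf ⊢
  intro m hm
  rcases Nat.lt_succ_iff_lt_or_eq.1 hm with h | rfl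
  · exact hf m h
  · exact hc

theorem exists_X_pow_succ_dvd_conjDefect {u : ℂ⟦X⟧} (hu : constantCoeff u ≠ 0) {r : ℕ}
    (hr : 1 ≤ r) (β : ℂ) {Φ : ℂ⟦X⟧} {k : ℕ} (hk : 2 ≤ k) (hkr : k ≠ r + 1)
    (h0 : constantCoeff Φ = 0) (h1 : coeff 1 Φ ^ r = constantCoeff u)
    (hΦ : X ^ (r + k) ∣ conjDefect u r β Φ) :
    ∃ Ψ : ℂ⟦X⟧, X ^ k ∣ Ψ - Φ ∧ constantCoeff Ψ = 0 ∧ coeff 1 Ψ ^ r = constantCoeff u ∧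
      X ^ (r + (k + 1)) ∣ conjDefect u r β Ψ := by
  obtain ⟨i, rfl⟩ : ∃ i, k = i + 2 := ⟨k - 2, by omega⟩
  have hi : (r : ℂ) - 1 - i ≠ 0 := by
    intro h
    have : (r : ℂ) = ((i + 1 : ℕ) : ℂ) := by push_cast; linear_combination h
    have := Nat.cast_injective this
    omega
  set c := -coeff (r + (i + 2)) (conjDefect u r β Φ) / (((r : ℂ) - 1 - i) * constantCoeff u)
    with hc
  have hstep := conjDefect_add_monomial u hr β c i h0 h1
  refine ⟨Φ + C c * X ^ (i + 2), by simp, by simp [h0], ?_, ?_⟩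
  · rw [map_add, coeff_C_mul, coeff_X_pow, if_neg (by omega), mul_zero, add_zero, h1]
  · rw [show r + (i + 2 + 1) = r + (i + 2) + 1 by ring]
    have h2 := X_pow_succ_dvd_of_coeff
      (f := conjDefect u r β Φ + C (c * ((r : ℂ) - 1 - i) * constantCoeff u) * X ^ (r + (i + 2)))
      (dvd_add hΦ (dvd_mul_left _ _)) (by
        rw [map_add, coeff_C_mul, coeff_X_pow, if_pos rfl, hc]
        field_simp
        ring)
    have := dvd_add hstep h2
    convert this using 1
    ring

theorem exists_limit_of_X_pow_dvd_sub (s : ℕ → ℂ⟦X⟧) (hs : ∀ n, X ^ n ∣ s (n + 1) - s n) :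
    ∃ Φ : ℂ⟦X⟧, ∀ n, X ^ n ∣ Φ - s n := by
  refine ⟨mk fun n => coeff n (s (n + 1)), fun n => X_pow_dvd_iff.2 fun m hm => ?_⟩
  rw [map_sub, coeff_mk, sub_eq_zero]
  induction n, hm using Nat.le_induction with
  | base => rfl
  | succ n hmn ih =>
    rw [ih, eq_comm, ← sub_eq_zero, ← map_sub]
    exact X_pow_dvd_iff.1 (hs n) m hmn

theorem exists_conjDefect_eq_zero {u : ℂ⟦X⟧} (hu : constantCoeff u ≠ 0) {r : ℕ} (hr : 1 ≤ r) :
    ∃ (β : ℂ) (Φ : ℂ⟦X⟧), constantCoeff Φ = 0 ∧ coeff 1 Φ ≠ 0 ∧ conjDefect u r β Φ = 0 := by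
  have hF : constantCoeff (X - X ^ (r + 1) * u) = 0 := by simp
  have hs := HasSubst.of_constantCoeff_zero' hF
  obtain ⟨l, hl⟩ := IsAlgClosed.exists_pow_nat_eq (constantCoeff u) hr
  have hone {Φ : ℂ⟦X⟧} (h : coeff 1 Φ ^ r = constantCoeff u) : coeff 1 Φ ≠ 0 := by
    intro h'
    rw [h', zero_pow (by omega)] at h
    exact hu h.symm
  have hlow : ∀ k, 2 ≤ k → k ≤ r + 1 → ∃ Φ : ℂ⟦X⟧, constantCoeff Φ = 0 ∧
      coeff 1 Φ ^ r = constantCoeff u ∧ X ^ (r + k) ∣ conjDefect u r 0 Φ := by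
    intro k hk
    induction k, hk using Nat.le_induction with
    | base =>
      intro _
      refine ⟨C l * X, by simp, by simpa using hl, ?_⟩
      obtain ⟨u', hu'⟩ := X_dvd_sub_C_constantCoeff u
      refine ⟨-C l * u', ?_⟩
      have : (C l * X : ℂ⟦X⟧).subst (X - X ^ (r + 1) * u) = C l * (X - X ^ (r + 1) * u) := by
        rw [subst_mul hs, subst_X hs]
        congr 1
        exact subst_C _
      rw [conjDefect, this, map_zero, mul_pow, pow_succ (C l), ← map_pow C l r, hl]
      linear_combination (-C l * X ^ (r + 1)) * hu'
    | succ k hk ih =>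
      intro hkr
      obtain ⟨Φ, h0, h1, hΦ⟩ := ih (by omega)
      obtain ⟨Ψ, -, hΨ⟩ := exists_X_pow_succ_dvd_conjDefect hu hr 0 hk (by omega) h0 h1 hΦ
      exact ⟨Ψ, hΨ⟩
  obtain ⟨Φ, h0, h1, hΦ⟩ := hlow (r + 1) (by omega) le_rfl
  set β := coeff (r + (r + 1)) (conjDefect u r 0 Φ) / coeff 1 Φ ^ (2 * r + 1) with hβ
  have hΦ' : X ^ (r + (r + 2)) ∣ conjDefect u r β Φ := by
    have e : conjDefect u r β Φ = conjDefect u r 0 Φ - C β * Φ ^ (2 * r + 1) := by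
      simp only [conjDefect, map_zero]; ring
    obtain ⟨v, rfl⟩ := X_dvd_iff.2 h0
    refine X_pow_succ_dvd_of_coeff (n := r + (r + 1)) ?_ ?_
    · rw [e]
      refine dvd_sub hΦ (Dvd.dvd.mul_left ?_ _)
      rw [mul_pow, show r + (r + 1) = 2 * r + 1 by ring]
      exact dvd_mul_right _ _
    · have hne := hone h1
      have hc : coeff (r + (r + 1)) ((X * v) ^ (2 * r + 1)) = coeff 1 (X * v) ^ (2 * r + 1) := by
        rw [mul_pow, show r + (r + 1) = 0 + (2 * r + 1) by ring, coeff_X_pow_mul]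
        simp
      rw [e, map_sub, coeff_C_mul, hc, hβ, div_mul_cancel₀ _ (pow_ne_zero _ hne), sub_self]
  let Q (i : ℕ) (Φ : ℂ⟦X⟧) : Prop := constantCoeff Φ = 0 ∧ coeff 1 Φ ^ r = constantCoeff u ∧
    X ^ (r + (r + 2 + i)) ∣ conjDefect u r β Φ
  have hnext (i : ℕ) (Φ : {Φ // Q i Φ}) : ∃ Ψ : {Ψ // Q (i + 1) Ψ}, X ^ i ∣ Ψ.1 - Φ.1 := by
    obtain ⟨Φ, h0, h1, hΦ⟩ := Φ
    obtain ⟨Ψ, h, hΨ⟩ := exists_X_pow_succ_dvd_conjDefect hu hr β (by omega) (by omega) h0 h1 hΦ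
    exact ⟨⟨Ψ, hΨ⟩, (pow_dvd_pow X (by omega)).trans h⟩
  choose next hnext using hnext
  let s (i : ℕ) : {Φ // Q i Φ} := Nat.rec ⟨Φ, h0, h1, hΦ'⟩ next i
  obtain ⟨Ψ, hΨ⟩ := exists_limit_of_X_pow_dvd_sub (fun i => (s i).1) fun i => hnext i (s i)
  have hcoeff (i m : ℕ) (hm : m < i) : coeff m Ψ = coeff m (s i).1 := by
    rw [← sub_eq_zero, ← map_sub]
    exact X_pow_dvd_iff.1 (hΨ i) m hm
  refine ⟨β, Ψ, ?_, ?_, ?_⟩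
  · rw [← coeff_zero_eq_constantCoeff_apply, hcoeff 1 0 one_pos,
      coeff_zero_eq_constantCoeff_apply]
    exact (s 1).2.1
  · rw [hcoeff 2 1 one_lt_two]
    exact hone (s 2).2.2.1
  · ext n
    have h : X ^ (n + 1) ∣ conjDefect u r β Ψ := by
      have h2 : X ^ (n + 1) ∣ conjDefect u r β (s (n + 1)).1 :=
        (pow_dvd_pow X (by omega)).trans (s (n + 1)).2.2.2
      simpa using dvd_add (X_pow_dvd_conjDefect_sub u r β (hΨ (n + 1))) h2
    exact X_pow_dvd_iff.1 h n (Nat.lt_succ_self n)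

/-- Formal normal form, with the residue of `(z - f z)⁻¹` as modulus. -/
theorem exists_subst_eq_normalForm {u : ℂ⟦X⟧} (hu : constantCoeff u ≠ 0) {r : ℕ} (hr : 1 ≤ r) :
    ∃ Φ : ℂ⟦X⟧, constantCoeff Φ = 0 ∧ coeff 1 Φ ≠ 0 ∧
      Φ.subst (X - X ^ (r + 1) * u) =
        (X - X ^ (r + 1) * (1 - C (coeff r u⁻¹) * X ^ r) : ℂ⟦X⟧).subst Φ := by
  obtain ⟨β, Φ, h0, h1, h⟩ := exists_conjDefect_eq_zero hu hr
  have hΦ := HasSubst.of_constantCoeff_zero' h0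
  have e (β : ℂ) : (X - X ^ (r + 1) * (1 - C β * X ^ r) : ℂ⟦X⟧).subst Φ =
      Φ - Φ ^ (r + 1) + C β * Φ ^ (2 * r + 1) := by
    have : (C β : ℂ⟦X⟧).subst Φ = C β := subst_C _
    rw [subst_sub hΦ, subst_X hΦ, X_pow_mul_subst h0, subst_sub hΦ, subst_mul hΦ, subst_pow hΦ,
      subst_X hΦ, this, ← coe_substAlgHom hΦ, map_one]
    ring
  have hconj : Φ.subst (X - X ^ (r + 1) * u) =
      (X - X ^ (r + 1) * (1 - C β * X ^ r) : ℂ⟦X⟧).subst Φ := by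
    rw [e]; exact sub_eq_zero.1 h
  obtain ⟨w, -, hw, hres⟩ := residue_eq_of_subst_eq h0 h1 hu hconj
  obtain rfl := mul_left_cancel₀ (pow_ne_zero _ X_ne_zero) hw
  rw [residue_normalForm hr] at hres
  exact ⟨Φ, h0, h1, hres ▸ hconj⟩

end FormalSeries

section Link
open PowerSeries

/-- The coefficients of a one-variable formal multilinear series, as a power series. -/
noncomputable def coeffSeries (p : FormalMultilinearSeries ℂ ℂ ℂ) : ℂ⟦X⟧ := mk p.coeff

theorem coeffSeries_injective : Function.Injective coeffSeries := by
  intro p q h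
  funext n
  rw [← p.mkPiRing_coeff_eq, ← q.mkPiRing_coeff_eq]
  have := congrArg (coeff n) h
  rw [coeffSeries, coeffSeries, coeff_mk, coeff_mk] at this
  rw [this]

theorem coeffSeries_ofScalars (c : ℕ → ℂ) :
    coeffSeries (FormalMultilinearSeries.ofScalars ℂ c) = mk c := by
  ext n
  simp [coeffSeries, FormalMultilinearSeries.coeff_ofScalars]

theorem coeff_comp_eq_sum (q p : FormalMultilinearSeries ℂ ℂ ℂ) (n : ℕ) :
    (q.comp p).coeff n =
      ∑ c : Composition n, q.coeff c.length * ∏ i, p.coeff (c.blocksFun i) := by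
  rw [FormalMultilinearSeries.coeff, FormalMultilinearSeries.comp, sum_apply]
  refine Finset.sum_congr rfl fun c _ => ?_
  rw [FormalMultilinearSeries.compAlongComposition_apply,
    FormalMultilinearSeries.apply_eq_prod_smul_coeff, smul_eq_mul, mul_comm]
  rfl

theorem coeffSeries_comp (q : FormalMultilinearSeries ℂ ℂ ℂ) {p : FormalMultilinearSeries ℂ ℂ ℂ}
    (hp : p.coeff 0 = 0) :
    coeffSeries (q.comp p) = (coeffSeries q).subst (coeffSeries p) := by
  have hP : constantCoeff (coeffSeries p) = 0 := by
    rw [← coeff_zero_eq_constantCoeff_apply, coeffSeries, coeff_mk, hp]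
  ext n
  have hpow (k : ℕ) : coeff n (coeffSeries p ^ k) =
      ∑ l ∈ Fintype.piFinset fun _ : Fin k => Finset.Ico 1 (n + 1),
        if ∑ i, l i = n then ∏ i, p.coeff (l i) else 0 := by
    have hdvd : X ^ (n + 1) ∣
        coeffSeries p - ∑ j ∈ Finset.Ico 1 (n + 1), C (p.coeff j) * X ^ j := by
      refine X_pow_dvd_iff.2 fun m hm => ?_
      rw [map_sub, map_sum, coeffSeries, coeff_mk, sub_eq_zero]
      simp only [coeff_C_mul, coeff_X_pow, mul_ite, mul_one, mul_zero, Finset.sum_ite_eq]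
      rcases Nat.eq_zero_or_pos m with rfl | h
      · simp [hp]
      · rw [if_pos (Finset.mem_Ico.2 ⟨h, hm⟩)]
    have h := X_pow_dvd_iff.1 (hdvd.trans (sub_dvd_pow_sub_pow _ _ k)) n (Nat.lt_succ_self n)
    rw [map_sub, sub_eq_zero] at h
    rw [h, ← Fin.prod_const, Finset.prod_univ_sum, map_sum]
    refine Finset.sum_congr rfl fun l _ => ?_
    rw [Finset.prod_mul_distrib, ← map_prod, Finset.prod_pow_eq_pow_sum, coeff_C_mul, coeff_X_pow]
    simp only [mul_ite, mul_one, mul_zero, eq_comm]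
  let f : (Σ k : ℕ, Fin k → ℕ) → ℂ := fun e =>
    if ∑ i, e.2 i = n then q.coeff e.1 * ∏ i, p.coeff (e.2 i) else 0
  let g : (Σ m, Composition m) → ℂ := fun e =>
    if e.1 = n then q.coeff e.2.length * ∏ i, p.coeff (e.2.blocksFun i) else 0
  have key := FormalMultilinearSeries.compChangeOfVariables_sum 0 (n + 1) (n + 1) f g (by
    rintro ⟨k, l⟩ he
    have hlen := FormalMultilinearSeries.compChangeOfVariables_length 0 (n + 1) (n + 1) he
    have hblocks := FormalMultilinearSeries.compChangeOfVariables_blocksFun 0 (n + 1) (n + 1) he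
    have hprod : ∏ i, p.coeff ((FormalMultilinearSeries.compChangeOfVariables 0 (n + 1) (n + 1)
        ⟨k, l⟩ he).2.blocksFun i) = ∏ i, p.coeff (l i) := by
      refine (Fintype.prod_equiv (finCongr hlen.symm) _ _ fun j => ?_).symm
      exact congrArg p.coeff (hblocks j).symm
    simp only [f, g, hprod, hlen]
    rfl)
  have hL : ∑ e ∈ FormalMultilinearSeries.compPartialSumSource 0 (n + 1) (n + 1), f e =
      coeff n ((coeffSeries q).subst (coeffSeries p)) := by
    rw [coeff_subst_eq_sum_range hP _ (Nat.lt_succ_self n),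
      FormalMultilinearSeries.compPartialSumSource, Finset.sum_sigma, Finset.range_eq_Ico]
    refine Finset.sum_congr rfl fun k _ => ?_
    rw [hpow, Finset.mul_sum]
    refine Finset.sum_congr rfl fun l _ => ?_
    simp only [f, mul_ite, mul_zero, coeffSeries, coeff_mk]
  rw [← hL, key, coeffSeries, coeff_mk, coeff_comp_eq_sum]
  have hsub : Finset.univ.map (Function.Embedding.sigmaMk (β := Composition) n) ⊆
      FormalMultilinearSeries.compPartialSumTarget 0 (n + 1) (n + 1) := by
    intro e he
    obtain ⟨c, -, rfl⟩ := Finset.mem_map.1 he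
    rw [FormalMultilinearSeries.mem_compPartialSumTarget_iff]
    exact ⟨Nat.zero_le _, Nat.lt_succ_of_le c.length_le,
      fun j => Nat.lt_succ_of_le (c.blocksFun_le j)⟩
  rw [← Finset.sum_subset hsub, Finset.sum_map]
  · simp [g]
  · rintro ⟨m, c⟩ - hm
    refine if_neg ?_
    rintro rfl
    exact hm (Finset.mem_map.2 ⟨c, Finset.mem_univ _, rfl⟩)

theorem coeff_eq_iteratedDeriv_div {f : ℂ → ℂ} {p : FormalMultilinearSeries ℂ ℂ ℂ} {z : ℂ}
    (hp : HasFPowerSeriesAt f p z) (n : ℕ) : p.coeff n = iteratedDeriv n f z / n.factorial := by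
  obtain ⟨ρ, hρ⟩ := hp
  have h := hρ.factorial_smul 1 n
  rw [iteratedFDeriv_apply_eq_iteratedDeriv_mul_prod, Finset.prod_const_one, one_smul,
    FormalMultilinearSeries.apply_eq_pow_smul_coeff, one_pow, one_smul, nsmul_eq_mul] at h
  rw [← h, mul_div_cancel_left₀ _ (mod_cast n.factorial_ne_zero)]

theorem coeffSeries_mul {f g : ℂ → ℂ} {p q s : FormalMultilinearSeries ℂ ℂ ℂ} {z : ℂ}
    (hp : HasFPowerSeriesAt f p z) (hq : HasFPowerSeriesAt g q z)
    (hs : HasFPowerSeriesAt (f * g) s z) :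
    coeffSeries s = coeffSeries p * coeffSeries q := by
  ext n
  rw [coeff_mul, Finset.Nat.sum_antidiagonal_eq_sum_range_succ_mk]
  simp only [coeffSeries, coeff_mk]
  rw [coeff_eq_iteratedDeriv_div hs, iteratedDeriv_mul hp.analyticAt.contDiffAt
    hq.analyticAt.contDiffAt, Finset.sum_div]
  refine Finset.sum_congr rfl fun k hk => ?_
  rw [coeff_eq_iteratedDeriv_div hp, coeff_eq_iteratedDeriv_div hq,
    Nat.cast_choose ℂ (Nat.lt_succ_iff.1 (Finset.mem_range.1 hk))]
  have h1 : (n.factorial : ℂ) ≠ 0 := mod_cast n.factorial_ne_zero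
  have h2 : (k.factorial : ℂ) ≠ 0 := mod_cast k.factorial_ne_zero
  have h3 : ((n - k).factorial : ℂ) ≠ 0 := mod_cast (n - k).factorial_ne_zero
  field_simp

/-- The residue of `(z - f z)⁻¹` at the origin, as a contour integral. -/
theorem exists_circleIntegral_eq_residue {f : ℂ → ℂ} {p : FormalMultilinearSeries ℂ ℂ ℂ}
    (hp : HasFPowerSeriesAt f p 0) {u : ℂ⟦X⟧} {r : ℕ} (hu : constantCoeff u ≠ 0)
    (hpu : coeffSeries p = X - X ^ (r + 1) * u) :
    ∃ ε₀ > (0 : ℝ), ∀ ε : ℝ, 0 < ε → ε < ε₀ →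
      coeff r u⁻¹ = (2 * (Real.pi : ℂ) * Complex.I)⁻¹ *
        circleIntegral (fun z => (z - f z)⁻¹) 0 ε := by
  obtain ⟨s, hs⟩ : AnalyticAt ℂ (fun z => z - f z) 0 := analyticAt_id.sub hp.analyticAt
  obtain ⟨i, hi⟩ : AnalyticAt ℂ (fun z : ℂ => z) 0 := analyticAt_id
  have hsu (n : ℕ) : s.coeff n = coeff n (X ^ (r + 1) * u) := by
    have h1 : s = i - p := hs.eq_formalMultilinearSeries (hi.sub hp)
    have h2 : p.coeff n = coeff n (X - X ^ (r + 1) * u) := by rw [← hpu, coeffSeries, coeff_mk]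
    have h3 : i.coeff n = coeff n (X : ℂ⟦X⟧) := by
      rw [coeff_eq_iteratedDeriv_div hi, coeff_X]
      rcases n with _ | _ | n
      · simp
      · simp [iteratedDeriv_one]
      · rw [iteratedDeriv_succ']
        simp [iteratedDeriv_succ']
    have h4 : s.coeff n = i.coeff n - p.coeff n := by rw [h1]; rfl
    rw [h4, h2, h3, map_sub]; ring
  set U := (Function.swap dslope 0)^[r + 1] (fun z => z - f z)
  have hU : HasFPowerSeriesAt U _ 0 := hs.has_fpower_series_iterate_dslope_fslope (r + 1)
  have hUu : coeffSeries (FormalMultilinearSeries.fslope^[r + 1] s) = u := by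
    ext n
    rw [coeffSeries, coeff_mk, FormalMultilinearSeries.coeff_iterate_fslope, hsu, coeff_X_pow_mul]
  have hU0 : U 0 ≠ 0 := by
    rw [← hU.coeff_zero 1]
    have := congrArg (coeff 0) hUu
    rw [coeffSeries, coeff_mk, coeff_zero_eq_constantCoeff_apply] at this
    rw [← this] at hu
    exact hu
  have hfact (z : ℂ) : z - f z = z ^ (r + 1) * U z := by
    have := pow_sub_smul_iterate_dslope_of_zero (a := 0) (f := fun z => z - f z) (r + 1)
      (fun k hk => ?_) z
    · rw [sub_zero, smul_eq_mul] at this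
      exact this.symm
    · rw [← (hs.has_fpower_series_iterate_dslope_fslope k).coeff_zero 1]
      change (FormalMultilinearSeries.fslope^[k] s).coeff 0 = 0
      rw [FormalMultilinearSeries.coeff_iterate_fslope, hsu]
      exact X_pow_dvd_iff.1 (dvd_mul_right _ _) _ (by omega)
  obtain ⟨w, hw⟩ := hU.analyticAt.inv hU0
  have hwu : coeffSeries w = u⁻¹ := by
    have h1 : HasFPowerSeriesAt (U * U⁻¹) (constFormalMultilinearSeries ℂ ℂ (1 : ℂ)) 0 := by
      refine hasFPowerSeriesAt_const.congr ?_
      filter_upwards [hU.analyticAt.continuousAt.eventually_ne hU0] with z hz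
      simp [mul_inv_cancel₀ hz]
    have h2 := coeffSeries_mul hU hw h1
    rw [hUu] at h2
    have h3 : coeffSeries (constFormalMultilinearSeries ℂ ℂ (1 : ℂ)) = 1 := by
      ext n
      rw [coeffSeries, coeff_mk, coeff_one]
      rcases n with _ | n <;> simp [FormalMultilinearSeries.coeff, constFormalMultilinearSeries]
    rw [h3] at h2
    rw [PowerSeries.eq_inv_iff_mul_eq_one hu, mul_comm, ← h2]
  obtain ⟨ε₀, hε₀, hball⟩ := Metric.eventually_nhds_iff_ball.1
    hw.analyticAt.eventually_analyticAt
  refine ⟨ε₀, hε₀, fun ε hε hlt => ?_⟩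
  have hd : DifferentiableOn ℂ U⁻¹ (Metric.closedBall 0 ε) := fun z hz =>
    (hball z (Metric.closedBall_subset_ball hlt hz)).differentiableAt.differentiableWithinAt
  have hint := hd.circleIntegral_one_div_sub_center_pow_smul hε r
  have hfun : (fun z => (z - f z)⁻¹) = fun z => (1 / (z - 0) ^ (r + 1)) • U⁻¹ z := by
    funext z
    rw [hfact]
    simp [mul_comm]
  rw [hfun, hint, ← hwu, coeffSeries, coeff_mk, coeff_eq_iteratedDeriv_div hw, smul_eq_mul]
  have := Complex.two_pi_I_ne_zero
  field_simp

end Link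

section Bridge
open PowerSeries

theorem coeffSeries_gSeries {r : ℕ} (hr : 1 ≤ r) (β : ℂ) :
    coeffSeries (gSeries r β) = X - X ^ (r + 1) * (1 - C β * X ^ r) := by
  have h : (X : ℂ⟦X⟧) - X ^ (r + 1) * (1 - C β * X ^ r) =
      X - X ^ (r + 1) + C β * X ^ (2 * r + 1) := by ring
  rw [h, gSeries, coeffSeries_ofScalars]
  ext n
  simp only [coeff_mk, map_add, map_sub, coeff_C_mul, coeff_X_pow, coeff_X]
  split_ifs <;> first | omega | simp

theorem comp_eq_comp_iff {Φ F G : FormalMultilinearSeries ℂ ℂ ℂ} (hΦ : Φ.coeff 0 = 0)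
    (hF : F.coeff 0 = 0) :
    Φ.comp F = G.comp Φ ↔
      (coeffSeries Φ).subst (coeffSeries F) = (coeffSeries G).subst (coeffSeries Φ) := by
  rw [← coeffSeries_injective.eq_iff, coeffSeries_comp _ hF, coeffSeries_comp _ hΦ]

theorem coeff_coeffSeries (p : FormalMultilinearSeries ℂ ℂ ℂ) (n : ℕ) :
    coeff n (coeffSeries p) = p.coeff n :=
  coeff_mk _ _

theorem exists_coeffSeries_eq_sub {f : ℂ → ℂ} {F : FormalMultilinearSeries ℂ ℂ ℂ}
    (hF : HasFPowerSeriesAt f F 0) (hf0 : f 0 = 0) {r : ℕ} (hd1 : deriv f 0 = 1)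
    (hvanish : ∀ k, 2 ≤ k → k ≤ r → iteratedDeriv k f 0 = 0)
    (hlead : iteratedDeriv (r + 1) f 0 ≠ 0) (hr : 1 ≤ r) :
    ∃ u : ℂ⟦X⟧, constantCoeff u ≠ 0 ∧ coeffSeries F = X - X ^ (r + 1) * u := by
  refine ⟨mk fun n => -F.coeff (n + (r + 1)), ?_, ?_⟩
  · rw [← coeff_zero_eq_constantCoeff_apply, coeff_mk, neg_ne_zero, zero_add,
      coeff_eq_iteratedDeriv_div hF]
    exact div_ne_zero hlead (mod_cast (r + 1).factorial_ne_zero)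
  · ext n
    rw [coeff_coeffSeries, map_sub, coeff_X_pow_mul', coeff_X]
    by_cases hn : r + 1 ≤ n
    · rw [if_pos hn, if_neg (by omega), coeff_mk, Nat.sub_add_cancel hn]
      ring
    · rw [if_neg hn, sub_zero, coeff_eq_iteratedDeriv_div hF]
      obtain rfl | rfl | h : n = 0 ∨ n = 1 ∨ 2 ≤ n := by omega
      · simp [hf0]
      · simp [iteratedDeriv_one, hd1]
      · rw [hvanish n h (by omega), if_neg (by omega), zero_div]

theorem IsHolConjVia.deriv_ne_zero {f₁ f₂ φ : ℂ → ℂ} {U₁ U₂ W₁ W₂ : Set ℂ}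
    (h : IsHolConjVia f₁ U₁ f₂ U₂ φ W₁ W₂) : deriv φ 0 ≠ 0 := by
  obtain ⟨hW₁, hW₂, h0₁, h0₂, -, -, hφ, -, ⟨ψ, hψ, hψφ⟩, hφ0, -⟩ := h
  have h1 : HasDerivAt φ (deriv φ 0) 0 := (hφ.differentiableAt (hW₁.mem_nhds h0₁)).hasDerivAt
  have h2 : HasDerivAt ψ (deriv ψ 0) (φ 0) := by
    rw [hφ0]
    exact (hψ.differentiableAt (hW₂.mem_nhds h0₂)).hasDerivAt
  have h3 : HasDerivAt (ψ ∘ φ) 1 0 :=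
    (hasDerivAt_id 0).congr_of_eventuallyEq (hψφ.eventuallyEq_of_mem (hW₁.mem_nhds h0₁))
  intro hz
  simpa [hz] using (h2.comp 0 h1).unique h3

theorem IsHolConjVia.comp_eq_comp {f₁ f₂ φ : ℂ → ℂ} {U₁ U₂ W₁ W₂ : Set ℂ}
    (h : IsHolConjVia f₁ U₁ f₂ U₂ φ W₁ W₂) (h₁ : f₁ 0 = 0)
    {Φ F₁ F₂ : FormalMultilinearSeries ℂ ℂ ℂ} (hΦ : HasFPowerSeriesAt φ Φ 0)
    (hF₁ : HasFPowerSeriesAt f₁ F₁ 0) (hF₂ : HasFPowerSeriesAt f₂ F₂ 0) :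
    Φ.comp F₁ = F₂.comp Φ := by
  obtain ⟨hW₁, -, h0₁, -, -, -, -, -, -, hφ0, hconj⟩ := h
  have e1 : HasFPowerSeriesAt (φ ∘ f₁) (Φ.comp F₁) 0 :=
    HasFPowerSeriesAt.comp (by rwa [h₁]) hF₁
  have e2 : HasFPowerSeriesAt (f₂ ∘ φ) (F₂.comp Φ) 0 :=
    HasFPowerSeriesAt.comp (by rwa [hφ0]) hΦ
  refine (e1.congr ?_).eq_formalMultilinearSeries e2
  have hmem : f₁ ⁻¹' W₁ ∈ 𝓝 (0 : ℂ) :=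
    hF₁.continuousAt.preimage_mem_nhds (by rw [h₁]; exact hW₁.mem_nhds h0₁)
  filter_upwards [hW₁.mem_nhds h0₁, hmem] with z hz hfz
  exact hconj z hz hfz

end Bridge

/-- **Formal classification of maps tangent to the identity.** A holomorphic local dynamical
system tangent to the identity with multiplicity `r+1 ≥ 2` is formally conjugated to
`g(z) = z - z^{r+1} + β z^{2r+1}`, where the index `β` is given by the contour integral
`β = (2πi)⁻¹ ∮_γ dz/(z - f(z))` over any small positive loop `γ` about the origin; two such
normal forms with different `β` are not formally conjugated, and `β` is invariant under
holomorphic local conjugation. -/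
theorem formal_normal_form_tangent_to_identity
    (f : ℂ → ℂ) (U : Set ℂ) (hU : IsOpen U) (h0 : (0 : ℂ) ∈ U)
    (hf : DifferentiableOn ℂ f U) (hf0 : f 0 = 0) (r : ℕ) (hr : 1 ≤ r)
    (hd1 : deriv f 0 = 1)
    (hvanish : ∀ k, 2 ≤ k → k ≤ r → iteratedDeriv k f 0 = 0)
    (hlead : iteratedDeriv (r + 1) f 0 ≠ 0) :
    ∃ β : ℂ,
      -- β is computed by the contour integral over every small positive loop about the origin
      (∃ ε₀ > (0 : ℝ), ∀ ε : ℝ, 0 < ε → ε < ε₀ →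
        β = (2 * (Real.pi : ℂ) * Complex.I)⁻¹ *
          circleIntegral (fun z => (z - f z)⁻¹) 0 ε) ∧
      -- f is formally conjugated to g(z) = z - z^{r+1} + β z^{2r+1}
      (∀ F : FormalMultilinearSeries ℂ ℂ ℂ, HasFPowerSeriesAt f F 0 →
        FormallyConj F (gSeries r β)) ∧
      -- maps of this form with different β are not formally conjugated
      (∀ β' : ℂ, FormallyConj (gSeries r β) (gSeries r β') → β' = β) ∧
      -- β is a holomorphic invariant
      (∀ (f₂ : ℂ → ℂ) (U₂ : Set ℂ), IsOpen U₂ → (0 : ℂ) ∈ U₂ →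
        DifferentiableOn ℂ f₂ U₂ → f₂ 0 = 0 → HolLocallyConj f U f₂ U₂ →
        ∃ ε₀ > (0 : ℝ), ∀ ε : ℝ, 0 < ε → ε < ε₀ →
          β = (2 * (Real.pi : ℂ) * Complex.I)⁻¹ *
            circleIntegral (fun z => (z - f₂ z)⁻¹) 0 ε) := by
  obtain ⟨F₀, hF₀⟩ := hf.analyticAt (hU.mem_nhds h0)
  obtain ⟨u, hu, hFu⟩ := exists_coeffSeries_eq_sub hF₀ hf0 hd1 hvanish hlead hr
  have hzero {g : ℂ → ℂ} {G : FormalMultilinearSeries ℂ ℂ ℂ} (hG : HasFPowerSeriesAt g G 0)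
      (hg : g 0 = 0) : G.coeff 0 = 0 := by
    rw [coeff_eq_iteratedDeriv_div hG]
    simp [hg]
  have hconst {G : FormalMultilinearSeries ℂ ℂ ℂ} (hG : G.coeff 0 = 0) :
      PowerSeries.constantCoeff (coeffSeries G) = 0 := by
    rw [← PowerSeries.coeff_zero_eq_constantCoeff_apply, coeff_coeffSeries, hG]
  refine ⟨PowerSeries.coeff r u⁻¹, exists_circleIntegral_eq_residue hF₀ hu hFu, ?_, ?_, ?_⟩
  · intro F hF
    obtain rfl := hF.eq_formalMultilinearSeries hF₀
    obtain ⟨Φ, hΦ0, hΦ1, hΦ⟩ := exists_subst_eq_normalForm hu hr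
    have hc (n : ℕ) : (FormalMultilinearSeries.ofScalars ℂ
        (fun n => PowerSeries.coeff n Φ)).coeff n = PowerSeries.coeff n Φ :=
      FormalMultilinearSeries.coeff_ofScalars
    have hmk : (PowerSeries.mk fun n => PowerSeries.coeff n Φ) = Φ := by
      ext n
      simp
    have h0' := hc 0
    rw [PowerSeries.coeff_zero_eq_constantCoeff_apply, hΦ0] at h0'
    refine ⟨FormalMultilinearSeries.ofScalars ℂ (fun n => PowerSeries.coeff n Φ), h0',
      by rwa [hc], ?_⟩
    rw [comp_eq_comp_iff h0' (hzero hF hf0), coeffSeries_gSeries hr, hFu, coeffSeries_ofScalars, hmk]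
    exact hΦ
  · rintro β' ⟨Φ, hΦ0, hΦ1, hΦ⟩
    have hg0 : (gSeries r (PowerSeries.coeff r u⁻¹)).coeff 0 = 0 := by
      rw [← coeff_coeffSeries, coeffSeries_gSeries hr]
      simp
    rw [comp_eq_comp_iff hΦ0 hg0, coeffSeries_gSeries hr, coeffSeries_gSeries hr] at hΦ
    obtain ⟨w, -, hw, hres⟩ := residue_eq_of_subst_eq (hconst hΦ0)
      (by rwa [coeff_coeffSeries]) (by simp [(show r ≠ 0 by omega)]) hΦ
    obtain rfl := mul_left_cancel₀ (pow_ne_zero _ PowerSeries.X_ne_zero) hw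
    rwa [residue_normalForm hr, residue_normalForm hr] at hres
  · rintro f₂ U₂ hU₂ h0₂ hf₂ hf₂0 ⟨φ, W₁, W₂, hφ⟩
    obtain ⟨F₂, hF₂⟩ := hf₂.analyticAt (hU₂.mem_nhds h0₂)
    obtain ⟨Φ, hΦ⟩ : AnalyticAt ℂ φ 0 :=
      hφ.2.2.2.2.2.2.1.analyticAt (hφ.1.mem_nhds hφ.2.2.1)
    have hφ0 : φ 0 = 0 := hφ.2.2.2.2.2.2.2.2.2.1
    have hconj := hφ.comp_eq_comp hf0 hΦ hF₀ hF₂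
    have hΦ1 : Φ.coeff 1 ≠ 0 := by
      rw [coeff_eq_iteratedDeriv_div hΦ, iteratedDeriv_one]
      simpa using hφ.deriv_ne_zero
    rw [comp_eq_comp_iff (hzero hΦ hφ0) (hzero hF₀ hf0), hFu,
      ← sub_sub_cancel PowerSeries.X (coeffSeries F₂)] at hconj
    obtain ⟨w, hw0, hw, hres⟩ := residue_eq_of_subst_eq (hconst (hzero hΦ hφ0))
      (by rwa [coeff_coeffSeries]) hu hconj
    rw [← hres]
    exact exists_circleIntegral_eq_residue hF₂ hw0 (by rw [← hw, sub_sub_cancel])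
end

section
/- Let f be a holomorphic local dynamical system at 0 ∈ ℂ whose multiplier λ = e^{2πiθ} satisfies θ ∉ ℚ. Then f is formally conjugated to its linear part z ↦ λz, by a unique formal power series h(z) = z + h₂z² + h₃z³ + ⋯ ∈ ℂ[[z]] tangent to the identity satisfying h(λz) = f(h(z)) as formal power series. -/
open Set Filter Topology

namespace FormalMultilinearSeries

variable {𝕜 : Type*} [NontriviallyNormedField 𝕜]

theorem coeff_comp_eq_sum (q p : FormalMultilinearSeries 𝕜 𝕜 𝕜) (n : ℕ) :
    (q.comp p).coeff n =
      ∑ c : Composition n, q.coeff c.length * ∏ i, p.coeff (c.blocksFun i) := by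
  simp only [coeff, FormalMultilinearSeries.comp, sum_apply]
  refine Finset.sum_congr rfl fun c _ => ?_
  rw [compAlongComposition_apply, apply_eq_prod_smul_coeff, smul_eq_mul, mul_comm]
  rfl

theorem ext_coeff {p q : FormalMultilinearSeries 𝕜 𝕜 𝕜} (h : ∀ n, p.coeff n = q.coeff n) :
    p = q := by
  ext1 n
  rw [← mkPiRing_coeff_eq p n, ← mkPiRing_coeff_eq q n, h n]

theorem coeff_ofScalars_self (a : ℕ → 𝕜) (n : ℕ) : (ofScalars 𝕜 a).coeff n = a n := by
  simp [coeff_ofScalars]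

/-- Composing on the right with the linear series `z ↦ lam * z` multiplies the `n`-th coefficient
by `lam ^ n`. -/
theorem coeff_comp_linear (h : FormalMultilinearSeries 𝕜 𝕜 𝕜) (lam : 𝕜) (n : ℕ) :
    (h.comp (ofScalars 𝕜 fun k => if k = 1 then lam else 0)).coeff n =
      lam ^ n * h.coeff n := by
  rw [coeff_comp_eq_sum, Finset.sum_eq_single (Composition.ones n)]
  · simp [Composition.ones_blocksFun, mul_comm]
  · intro c _ hc
    obtain ⟨i, hi, hi1⟩ := Composition.ne_ones_iff.1 hc
    obtain ⟨j, rfl⟩ : ∃ j, c.blocksFun j = i := by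
      rwa [← Composition.ofFn_blocksFun, List.mem_ofFn] at hi
    rw [Finset.prod_eq_zero (Finset.mem_univ j), mul_zero]
    rw [coeff_ofScalars_self, if_neg hi1.ne']
  · simp

/-- The contribution to the `n`-th coefficient of a composition of power series (with coefficients
`a` outside and `b` inside) in which only the inner coefficients of index less than `n` occur. -/
def compLowerPart (a b : ℕ → 𝕜) (n : ℕ) : 𝕜 :=
  ∑ c : Composition n, a c.length * ∏ i, if c.blocksFun i < n then b (c.blocksFun i) else 0

theorem compLowerPart_congr (a : ℕ → 𝕜) {b b' : ℕ → 𝕜} {n : ℕ} (h : ∀ k < n, b k = b' k) :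
    compLowerPart a b n = compLowerPart a b' n := by
  refine Finset.sum_congr rfl fun c _ => congrArg _ (Finset.prod_congr rfl fun i _ => ?_)
  split_ifs with hi
  · exact h _ hi
  · rfl

theorem coeff_comp_eq_add_compLowerPart (q p : FormalMultilinearSeries 𝕜 𝕜 𝕜) {n : ℕ}
    (hn : 0 < n) :
    (q.comp p).coeff n = q.coeff 1 * p.coeff n + compLowerPart q.coeff p.coeff n := by
  rw [coeff_comp_eq_sum, compLowerPart,
    ← Finset.add_sum_erase _ _ (Finset.mem_univ (Composition.single n hn)),
    ← Finset.add_sum_erase Finset.univ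
      (fun c : Composition n => q.coeff c.length *
        ∏ i, if c.blocksFun i < n then p.coeff (c.blocksFun i) else 0)
      (Finset.mem_univ (Composition.single n hn))]
  have hsingle : ∏ i, p.coeff ((Composition.single n hn).blocksFun i) = p.coeff n := by
    simp only [Composition.single_blocksFun]
    rw [Finset.prod_const, Finset.card_univ, Fintype.card_fin, Composition.single_length, pow_one]
  have hzero : (∏ i, if (Composition.single n hn).blocksFun i < n
      then p.coeff ((Composition.single n hn).blocksFun i) else 0) = 0 :=
    Finset.prod_eq_zero (Finset.mem_univ ⟨0, by simp⟩) (by rw [Composition.single_blocksFun, if_neg n.lt_irrefl])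
  rw [hsingle, hzero, mul_zero, zero_add, Composition.single_length]
  refine congrArg _ (Finset.sum_congr rfl fun c hc => congrArg _ ?_)
  have hlt := (Composition.ne_single_iff hn).1 (Finset.ne_of_mem_erase hc)
  exact Finset.prod_congr rfl fun i _ => (if_pos (hlt i)).symm

/-- The coefficients of the formal linearization of the power series with coefficients `a` and
multiplier `lam`. -/
noncomputable def linearizationCoeff (a : ℕ → 𝕜) (lam : 𝕜) : ℕ → 𝕜
  | 0 => 0
  | 1 => 1
  | n + 2 => (lam ^ (n + 2) - lam)⁻¹ * ∑ c : Composition (n + 2), a c.length *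
      ∏ i, if _hi : c.blocksFun i < n + 2 then linearizationCoeff a lam (c.blocksFun i) else 0

theorem linearizationCoeff_add_two (a : ℕ → 𝕜) (lam : 𝕜) (n : ℕ) :
    linearizationCoeff a lam (n + 2) =
      (lam ^ (n + 2) - lam)⁻¹ * compLowerPart a (linearizationCoeff a lam) (n + 2) := by
  rw [linearizationCoeff, compLowerPart]
  simp only [dite_eq_ite]

/-- A formal power series fixing the origin whose multiplier `lam` is non-resonant, in the sense
that `lam ^ n ≠ lam` for `n ≥ 2`, has a unique formal linearization tangent to the identity. -/
theorem existsUnique_linearization (F : FormalMultilinearSeries 𝕜 𝕜 𝕜) (lam : 𝕜)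
    (hF0 : F.coeff 0 = 0) (hF1 : F.coeff 1 = lam) (hlam : ∀ n, lam ^ (n + 2) ≠ lam) :
    ∃! h : FormalMultilinearSeries 𝕜 𝕜 𝕜,
      h.coeff 0 = 0 ∧ h.coeff 1 = 1 ∧
      h.comp (ofScalars 𝕜 fun n => if n = 1 then lam else 0) = F.comp h := by
  have hrec (h : FormalMultilinearSeries 𝕜 𝕜 𝕜) (n : ℕ) :
      (h.comp (ofScalars 𝕜 fun n => if n = 1 then lam else 0)).coeff (n + 2) =
          (F.comp h).coeff (n + 2) ↔
        h.coeff (n + 2) =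
          (lam ^ (n + 2) - lam)⁻¹ * compLowerPart F.coeff h.coeff (n + 2) := by
    rw [coeff_comp_linear, coeff_comp_eq_add_compLowerPart _ _ (by omega), hF1,
      eq_inv_mul_iff_mul_eq₀ (sub_ne_zero.2 (hlam n)), sub_mul, sub_eq_iff_eq_add']
  refine ⟨ofScalars 𝕜 (linearizationCoeff F.coeff lam), ⟨?_, ?_, ext_coeff fun n => ?_⟩, ?_⟩
  · rw [coeff_ofScalars_self, linearizationCoeff]
  · rw [coeff_ofScalars_self, linearizationCoeff]
  · match n with
    | 0 =>
      rw [coeff_comp_linear, coeff_ofScalars_self, linearizationCoeff, mul_zero,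
        coeff_comp_eq_sum]
      refine (Finset.sum_eq_zero fun c _ => ?_).symm
      have hc : F.coeff c.length = 0 := by rw [Nat.le_zero.1 c.length_le, hF0]
      rw [hc, zero_mul]
    | 1 =>
      rw [coeff_comp_linear, coeff_comp_eq_add_compLowerPart _ _ one_pos, hF1, pow_one,
        left_eq_add]
      refine Finset.sum_eq_zero fun c _ => ?_
      have hc : 0 < c.length := c.length_pos_of_pos one_pos
      rw [Finset.prod_eq_zero (Finset.mem_univ ⟨0, hc⟩), mul_zero]
      exact if_neg (not_lt.2 (c.one_le_blocksFun _))
    | n + 2 =>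
      rw [hrec, coeff_ofScalars_self, linearizationCoeff_add_two]
      congr 1
      exact compLowerPart_congr _ fun k _ => (coeff_ofScalars_self _ k).symm
  · rintro h ⟨h0, h1, hh⟩
    refine ext_coeff fun n => ?_
    rw [coeff_ofScalars_self]
    induction n using Nat.strong_induction_on with
    | _ n ih =>
      match n with
      | 0 => rw [h0, linearizationCoeff]
      | 1 => rw [h1, linearizationCoeff]
      | n + 2 =>
        rw [(hrec h n).1 (by rw [hh]), linearizationCoeff_add_two, compLowerPart_congr _ ih]

end FormalMultilinearSeries

theorem Irrational.exp_two_pi_mul_I_pow_ne {θ : ℝ} (hθ : Irrational θ) (n : ℕ) :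
    Complex.exp (2 * (Real.pi : ℂ) * Complex.I * (θ : ℂ)) ^ (n + 2) ≠
      Complex.exp (2 * (Real.pi : ℂ) * Complex.I * (θ : ℂ)) := by
  intro h
  rw [← Complex.exp_nat_mul, Complex.exp_eq_exp_iff_exists_int] at h
  obtain ⟨k, hk⟩ := h
  have hmul : (((n + 1 : ℕ) : ℂ)) * θ = k := by
    apply mul_left_cancel₀ Complex.two_pi_I_ne_zero
    push_cast at hk ⊢
    linear_combination hk
  exact (hθ.natCast_mul n.succ_ne_zero).ne_int k (by exact_mod_cast hmul)

/-- **Formal linearization in the elliptic case.** Let `f` be a holomorphic local dynamical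
system at `0 ∈ ℂ` whose multiplier is `λ = e^{2πiθ}` with `θ` irrational. Identifying `f` with
its (convergent) power series `F` at `0`, there is a unique formal power series
`h(z) = z + h₂ z² + ⋯` tangent to the identity such that `h(λ z) = f(h(z))` as formal power
series; in particular `f` is formally conjugated to its linear part. -/
theorem formal_linearization_elliptic
    (f : ℂ → ℂ) (U : Set ℂ) (hU : IsOpen U) (h0 : (0 : ℂ) ∈ U)
    (hf : DifferentiableOn ℂ f U) (hf0 : f 0 = 0) (hfne : ∃ z ∈ U, f z ≠ z)
    (θ : ℝ) (hθ : Irrational θ) (lam : ℂ)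
    (hlam : lam = Complex.exp (2 * (Real.pi : ℂ) * Complex.I * (θ : ℂ)))
    (hmult : deriv f 0 = lam)
    (F : FormalMultilinearSeries ℂ ℂ ℂ) (hF : HasFPowerSeriesAt f F 0) :
    ∃! h : FormalMultilinearSeries ℂ ℂ ℂ,
      h.coeff 0 = 0 ∧ h.coeff 1 = 1 ∧
      h.comp (FormalMultilinearSeries.ofScalars ℂ fun n => if n = 1 then lam else 0) =
        F.comp h := by
  have hF0 : F.coeff 0 = 0 := (hF.coeff_zero _).trans hf0
  have hF1 : F.coeff 1 = lam := hF.deriv.symm.trans hmult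
  subst hlam
  exact F.existsUnique_linearization _ hF0 hF1 hθ.exp_two_pi_mul_I_pow_ne
end
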